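/- arXiv:2511.15508 — 3 statements merged into one kernel-verified Lean document; each statement's English description precedes it below -/
import Mathlib

section
/- Let n ≥ 2k ≥ 6, let F ⊆ \binom{[n]}{k} be an intersecting family, and let u ∈ [n] satisfy |F(u)| = d_1(F). If there exists v ∈ [n] \ {u} with |F(ū, v)| ≥ 5·\binom{n-4}{k-3}, then the fourth largest degree satisfies d_4(F) ≤ 6·\binom{n-3}{k-3}. -/
open Finset

/-- The degree of `x` in the family `F`: the number of members of `F` containing `x`. -/
def degree (F : Finset (Finset ℕ)) (x : ℕ) : ℕ :=
  (F.filter fun A => x ∈ A).card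

/-- The `i`-th largest degree (1-indexed) of the family `F` on ground set `[n] = {1, …, n}`:
the `i`-th entry of the list of degrees of all `n` elements arranged in nonincreasing order. -/
def nthDegree (n : ℕ) (F : Finset (Finset ℕ)) (i : ℕ) : ℕ :=
  (((Finset.Icc 1 n).val.map (degree F)).sort (· ≥ ·)).getD (i - 1) 0

/-- Number of elements of `X` below `j`. -/
def cnt (X : Finset ℕ) (j : ℕ) : ℕ := (X.filter (· < j)).card

theorem cnt_zero (X : Finset ℕ) : cnt X 0 = 0 := by simp [cnt]

theorem cnt_succ (X : Finset ℕ) (j : ℕ) : cnt X (j + 1) = cnt X j + if j ∈ X then 1 else 0 := by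
  unfold cnt
  split_ifs with h
  · have : X.filter (· < j + 1) = insert j (X.filter (· < j)) := by
      ext y; simp only [mem_filter, mem_insert]
      constructor
      · rintro ⟨h1, h2⟩
        by_cases hy : y = j
        · exact Or.inl hy
        · exact Or.inr ⟨h1, by omega⟩
      · rintro (h1 | ⟨h1, h2⟩)
        · subst h1; exact ⟨h, by omega⟩
        · exact ⟨h1, by omega⟩
    rw [this, card_insert_of_notMem (by simp)]
  · congr 1
    ext y; simp only [mem_filter]
    constructor
    · rintro ⟨h1, h2⟩
      have : y ≠ j := fun e => h (e ▸ h1)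
      exact ⟨h1, by omega⟩
    · rintro ⟨h1, h2⟩; exact ⟨h1, by omega⟩

theorem cnt_le_card (X : Finset ℕ) (j : ℕ) : cnt X j ≤ X.card := card_filter_le _ _

theorem cnt_mono {X Y : Finset ℕ} (h : X ⊆ Y) (j : ℕ) : cnt X j ≤ cnt Y j :=
  card_le_card (filter_subset_filter _ h)

theorem cnt_big (X : Finset ℕ) : ∃ J, cnt X J = X.card := by
  refine ⟨X.sup id + 1, ?_⟩
  unfold cnt
  rw [filter_true_of_mem]
  intro x hx
  have := Finset.le_sup (f := id) hx
  simp only [id] at this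
  omega

theorem cnt_insert {X : Finset ℕ} {x : ℕ} (hx : x ∉ X) (j : ℕ) :
    cnt (insert x X) j = cnt X j + if x < j then 1 else 0 := by
  unfold cnt
  rw [filter_insert]
  split_ifs with h
  · rw [card_insert_of_notMem (by simp [hx])]
  · rfl

/-- subset of `W` selected by ranks -/
def rkset (W : Finset ℕ) (p : ℕ → Prop) [DecidablePred p] : Finset ℕ :=
  W.filter fun w => p (cnt W w)

theorem cnt_rkset (W : Finset ℕ) (p : ℕ → Prop) [DecidablePred p] (f : ℕ → ℕ) (h0 : f 0 = 0)
    (hs : ∀ c, f (c + 1) = f c + if p c then 1 else 0) (j : ℕ) :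
    cnt (rkset W p) j = f (cnt W j) := by
  induction j with
  | zero => simp [cnt_zero, h0]
  | succ j ih =>
    rw [cnt_succ, cnt_succ, ih]
    by_cases hj : j ∈ W
    · simp [rkset, hj, hs]
    · simp [rkset, hj]

theorem card_rkset (W : Finset ℕ) (p : ℕ → Prop) [DecidablePred p] (f : ℕ → ℕ) (h0 : f 0 = 0)
    (hs : ∀ c, f (c + 1) = f c + if p c then 1 else 0) :
    (rkset W p).card = f W.card := by
  obtain ⟨J, hJ⟩ := cnt_big (rkset W p)
  have h1 := cnt_rkset W p f h0 hs
  obtain ⟨J', hJ'⟩ := cnt_big W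
  have hm : Monotone f := monotone_nat_of_le_succ (fun c => by rw [hs]; omega)
  apply le_antisymm
  · rw [← hJ, h1]; exact hm (cnt_le_card _ _)
  · rw [← hJ', ← h1]; exact cnt_le_card _ _

open Classical in
/-- Number of sets whose walk reaches height `t`. -/
theorem card_hit (W : Finset ℕ) : ∀ a t : ℕ,
    ((powersetCard a W).filter fun A => ∃ j, cnt W j + t ≤ 2 * cnt A j).card
      ≤ W.card.choose (W.card + t - a) := by
  induction W using Finset.induction_on_min with
  | empty =>
    intro a t
    rcases Nat.eq_zero_or_pos t with rfl | ht
    · rcases Nat.eq_zero_or_pos a with rfl | ha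
      · simp [cnt]
      · rw [powersetCard_eq_empty.2 (by simpa using ha)]; simp
    · rw [filter_false_of_mem]
      · simp
      · intro A hA
        rw [mem_powersetCard] at hA
        have : A = ∅ := subset_empty.1 hA.1
        subst this
        simp [cnt]; omega
  | insert x W hx ih =>
    intro a t
    have hxW : x ∉ W := fun h => lt_irrefl _ (hx x h)
    rw [card_insert_of_notMem hxW]
    by_cases ha : W.card + 1 < a
    · rw [powersetCard_eq_empty.2 (by rw [card_insert_of_notMem hxW]; exact ha)]; simp
    rcases Nat.eq_zero_or_pos t with rfl | ht
    · refine (card_filter_le _ _).trans ?_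
      rw [card_powersetCard, card_insert_of_notMem hxW, Nat.add_zero, Nat.choose_symm (by omega)]
    have key : ∀ A : Finset ℕ, A ⊆ insert x W → ∀ j, j ≤ x → cnt A j = 0 := by
      intro A hA j hj
      unfold cnt
      rw [card_eq_zero, filter_eq_empty_iff]
      intro y hy
      rcases mem_insert.1 (hA hy) with rfl | h
      · omega
      · have := hx y h; omega
    have hsub : ((powersetCard a (insert x W)).filter
        fun A => ∃ j, cnt (insert x W) j + t ≤ 2 * cnt A j) ⊆
        (((powersetCard (a - 1) W).filter fun A => ∃ j, cnt W j + (t - 1) ≤ 2 * cnt A j).image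
          (insert x)).filter (fun _ => 1 ≤ a) ∪
        ((powersetCard a W).filter fun A => ∃ j, cnt W j + (t + 1) ≤ 2 * cnt A j) := by
      intro A hA
      rw [mem_filter, mem_powersetCard] at hA
      obtain ⟨⟨hA1, hA2⟩, j, hj⟩ := hA
      have hxj : x < j := by
        by_contra h
        have := key A hA1 j (by omega)
        omega
      rw [cnt_insert hxW, if_pos hxj] at hj
      rw [mem_union]
      by_cases hxA : x ∈ A
      · left
        rw [mem_filter, mem_image]
        have hc := card_erase_of_mem hxA
        refine ⟨⟨A.erase x, ?_, insert_erase hxA⟩, ?_⟩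
        · rw [mem_filter, mem_powersetCard]
          refine ⟨⟨?_, by omega⟩, j, ?_⟩
          · rw [← subset_insert_iff]; exact hA1
          · have := cnt_insert (notMem_erase x A) j
            rw [insert_erase hxA, if_pos hxj] at this
            omega
        · have := card_pos.2 ⟨x, hxA⟩; omega
      · right
        rw [mem_filter, mem_powersetCard]
        refine ⟨⟨?_, hA2⟩, j, by omega⟩
        exact (subset_insert_iff_of_notMem hxA).1 hA1
    refine (card_le_card hsub).trans ((card_union_le _ _).trans ?_)
    have h2 := ih a (t + 1)
    rcases Nat.eq_zero_or_pos a with rfl | ha0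
    · rw [filter_false_of_mem (by intros; omega), card_empty, zero_add]
      refine h2.trans ?_
      rw [Nat.choose_eq_zero_of_lt (by omega)]; omega
    have h1 : ((((powersetCard (a - 1) W).filter
        fun A => ∃ j, cnt W j + (t - 1) ≤ 2 * cnt A j).image
          (insert x)).filter (fun _ => 1 ≤ a)).card ≤ W.card.choose (W.card + (t - 1) - (a - 1)) :=
      (card_filter_le _ _).trans (card_image_le.trans (ih (a - 1) (t - 1)))
    have e1 : W.card + (t - 1) - (a - 1) = W.card + t - a := by omega
    have e2 : W.card + (t + 1) - a = W.card + t - a + 1 := by omega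
    have e3 : W.card + 1 + t - a = W.card + t - a + 1 := by omega
    rw [e1] at h1
    rw [e2] at h2
    rw [e3, Nat.choose_succ_succ]
    exact Nat.add_le_add h1 h2

/-! ### Shifting -/

def mv (i j : ℕ) (s : Finset (Finset ℕ)) (a : Finset ℕ) : Finset ℕ :=
  if j ∈ a ∧ i ∉ a ∧ insert i (a.erase j) ∉ s then insert i (a.erase j) else a

def sh (i j : ℕ) (s : Finset (Finset ℕ)) : Finset (Finset ℕ) := s.image (mv i j s)

theorem mv_inj (i j : ℕ) (s : Finset (Finset ℕ)) : Set.InjOn (mv i j s) s := by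
  intro a ha b hb hab
  simp only [mem_coe] at ha hb
  unfold mv at hab
  split_ifs at hab with h1 h2 h2
  · have e : ∀ c : Finset ℕ, j ∈ c → i ∉ c → insert j ((insert i (c.erase j)).erase i) = c := by
      intro c hj hi
      rw [erase_insert (by simp [hi]), insert_erase hj]
    rw [← e a h1.1 h1.2.1, ← e b h2.1 h2.2.1, hab]
  · rw [hab] at h1; exact absurd hb h1.2.2
  · rw [← hab] at h2; exact absurd ha h2.2.2
  · exact hab

theorem card_sh (i j : ℕ) (s : Finset (Finset ℕ)) : (sh i j s).card = s.card :=
  card_image_of_injOn (mv_inj i j s)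

def Shd (W : Finset ℕ) (A : Finset (Finset ℕ)) : Prop :=
  ∀ a ∈ A, ∀ i ∈ W, ∀ j ∈ W, i < j → j ∈ a → i ∉ a → insert i (a.erase j) ∈ A

def wt (s : Finset (Finset ℕ)) : ℕ := ∑ a ∈ s, ∑ x ∈ a, x

theorem wt_mv {i j : ℕ} (hij : i < j) (s : Finset (Finset ℕ)) (a : Finset ℕ) :
    ∑ x ∈ mv i j s a, x ≤ ∑ x ∈ a, x ∧
    (j ∈ a ∧ i ∉ a ∧ insert i (a.erase j) ∉ s → ∑ x ∈ mv i j s a, x < ∑ x ∈ a, x) := by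
  unfold mv
  split_ifs with h
  · have h1 : ∑ x ∈ insert i (a.erase j), x = i + ∑ x ∈ a.erase j, x :=
      sum_insert (by simp [h.2.1])
    have h2 : ∑ x ∈ a.erase j, x + j = ∑ x ∈ a, x := sum_erase_add a (fun x => x) h.1
    exact ⟨by omega, fun _ => by omega⟩
  · exact ⟨le_rfl, fun h' => absurd h' h⟩

theorem wt_sh_le {i j : ℕ} (hij : i < j) (s : Finset (Finset ℕ)) : wt (sh i j s) ≤ wt s := by
  unfold wt sh
  rw [sum_image (mv_inj i j s)]
  exact sum_le_sum fun a _ => (wt_mv hij s a).1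

theorem wt_sh_lt {i j : ℕ} (hij : i < j) (s : Finset (Finset ℕ))
    (h : ∃ a ∈ s, j ∈ a ∧ i ∉ a ∧ insert i (a.erase j) ∉ s) : wt (sh i j s) < wt s := by
  unfold wt sh
  rw [sum_image (mv_inj i j s)]
  obtain ⟨a, ha, h⟩ := h
  exact sum_lt_sum (fun a _ => (wt_mv hij s a).1) ⟨a, ha, (wt_mv hij s a).2 h⟩

theorem exists_shd (W : Finset ℕ) (Q : Finset (Finset ℕ) → Finset (Finset ℕ) → Prop)
    (hQ : ∀ A B, Q A B → ∀ i ∈ W, ∀ j ∈ W, i < j → Q (sh i j A) (sh i j B)) :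
    ∀ N A B, wt A + wt B = N → Q A B → ∃ A B, Q A B ∧ Shd W A ∧ Shd W B := by
  intro N
  induction N using Nat.strong_induction_on with
  | _ N ih =>
    intro A B hN hAB
    by_cases h : Shd W A ∧ Shd W B
    · exact ⟨A, B, hAB, h⟩
    have : ∃ i ∈ W, ∃ j ∈ W, i < j ∧ wt (sh i j A) + wt (sh i j B) < N := by
      rw [not_and_or] at h
      rcases h with h | h
      · unfold Shd at h
        push Not at h
        obtain ⟨a, ha, i, hi, j, hj, hij, h1, h2, h3⟩ := h
        refine ⟨i, hi, j, hj, hij, ?_⟩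
        have := wt_sh_lt hij A ⟨a, ha, h1, h2, h3⟩
        have := wt_sh_le hij B
        omega
      · unfold Shd at h
        push Not at h
        obtain ⟨a, ha, i, hi, j, hj, hij, h1, h2, h3⟩ := h
        refine ⟨i, hi, j, hj, hij, ?_⟩
        have := wt_sh_lt hij B ⟨a, ha, h1, h2, h3⟩
        have := wt_sh_le hij A
        omega
    obtain ⟨i, hi, j, hj, hij, hlt⟩ := this
    exact ih _ hlt _ _ rfl (hQ A B hAB i hi j hj hij)

def Cr (W : Finset ℕ) (a b : ℕ) (A B : Finset (Finset ℕ)) : Prop :=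
  A ⊆ powersetCard a W ∧ B ⊆ powersetCard b W ∧ ∀ x ∈ A, ∀ y ∈ B, (x ∩ y).Nonempty

theorem sh_sub {W : Finset ℕ} {a i j : ℕ} {A : Finset (Finset ℕ)} (hi : i ∈ W)
    (hA : A ⊆ powersetCard a W) : sh i j A ⊆ powersetCard a W := by
  intro x hx
  obtain ⟨y, hy, rfl⟩ := mem_image.1 hx
  have h := mem_powersetCard.1 (hA hy)
  unfold mv
  split_ifs with hc
  · rw [mem_powersetCard]
    refine ⟨insert_subset hi ((erase_subset _ _).trans h.1), ?_⟩
    rw [card_insert_of_notMem (by simp [hc.2.1]), card_erase_of_mem hc.1, h.2]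
    have := card_pos.2 ⟨j, hc.1⟩
    omega
  · exact hA hy

theorem cross_aux {i j : ℕ} {B : Finset (Finset ℕ)} {x y : Finset ℕ}
    (hxy : ∀ y ∈ B, (x ∩ y).Nonempty) (hy : y ∈ B) (hx : j ∈ x ∧ i ∉ x)
    (hny : ¬ (j ∈ y ∧ i ∉ y ∧ insert i (y.erase j) ∉ B)) :
    (insert i (x.erase j) ∩ y).Nonempty := by
  by_cases hiy : i ∈ y
  · exact ⟨i, by simp [hiy]⟩
  by_cases hjy : j ∈ y
  · have hB : insert i (y.erase j) ∈ B := by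
      by_contra h; exact hny ⟨hjy, hiy, h⟩
    obtain ⟨w, hw⟩ := hxy _ hB
    simp only [mem_inter, mem_insert, mem_erase] at hw
    obtain ⟨h1, h2 | h2⟩ := hw
    · subst h2; exact absurd h1 hx.2
    · exact ⟨w, by simp [h1, h2.1, h2.2]⟩
  · obtain ⟨w, hw⟩ := hxy _ hy
    rw [mem_inter] at hw
    have : w ≠ j := fun e => hjy (e ▸ hw.2)
    exact ⟨w, by simp [hw.1, hw.2, this]⟩

theorem Cr_sh {W : Finset ℕ} {a b : ℕ} {A B : Finset (Finset ℕ)} (h : Cr W a b A B)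
    {i j : ℕ} (hi : i ∈ W) : Cr W a b (sh i j A) (sh i j B) := by
  obtain ⟨hA, hB, hc⟩ := h
  refine ⟨sh_sub hi hA, sh_sub hi hB, ?_⟩
  intro x' hx' y' hy'
  obtain ⟨x, hx, rfl⟩ := mem_image.1 hx'
  obtain ⟨y, hy, rfl⟩ := mem_image.1 hy'
  unfold mv
  split_ifs with h1 h2 h2
  · exact ⟨i, by simp⟩
  · exact cross_aux (hc x hx) hy ⟨h1.1, h1.2.1⟩ h2
  · rw [inter_comm]
    exact cross_aux (fun z hz => by rw [inter_comm]; exact hc z hz y hy) hx ⟨h2.1, h2.2.1⟩ h1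
  · exact hc x hx y hy

theorem degree_sh (i j : ℕ) (A : Finset (Finset ℕ)) (R : ℕ) (h : ∀ z, z ≠ i → degree A z ≤ R)
    (z : ℕ) (hz : z ≠ i) : degree (sh i j A) z ≤ R := by
  refine le_trans ?_ (h z hz)
  unfold degree sh
  rw [filter_image]
  refine card_image_le.trans (card_le_card ?_)
  intro a
  simp only [mem_filter]
  rintro ⟨h1, h2⟩
  refine ⟨h1, ?_⟩
  unfold mv at h2
  split_ifs at h2
  · simp only [mem_insert, mem_erase] at h2
    rcases h2 with h2 | h2
    · exact absurd h2 hz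
    · exact h2.2
  · exact h2

theorem degree_sh_i (i j : ℕ) (A : Finset (Finset ℕ)) :
    degree (sh i j A) i ≤ degree A i + degree A j := by
  unfold degree sh
  rw [filter_image]
  refine card_image_le.trans ((card_le_card ?_).trans (card_union_le _ _))
  intro a
  simp only [mem_filter, mem_union]
  rintro ⟨h1, h2⟩
  unfold mv at h2
  split_ifs at h2 with hc
  · exact Or.inr ⟨h1, hc.1⟩
  · exact Or.inl ⟨h1, h2⟩

/-- Shifted families are closed under dominance. -/
theorem dom (W : Finset ℕ) (A : Finset (Finset ℕ)) (hA : Shd W A) (X : Finset ℕ) (hX : X ⊆ W) :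
    ∀ N : ℕ, ∀ a ∈ A, (a \ X).card = N → a ⊆ W → a.card = X.card →
      (∀ t, cnt a t ≤ cnt X t) → X ∈ A := by
  intro N
  induction N with
  | zero =>
    intro a ha h0 haW hc _
    have : a ⊆ X := by
      rw [← sdiff_eq_empty_iff_subset]; exact card_eq_zero.1 h0
    rwa [← eq_of_subset_of_card_le this hc.ge]
  | succ N ih =>
    intro a ha hN haW hc hd
    have hne : (a \ X).Nonempty := card_pos.1 (by omega)
    set j := (a \ X).min' hne with hj
    have hja : j ∈ a \ X := min'_mem _ _
    rw [mem_sdiff] at hja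
    have hmin : ∀ y ∈ a, y < j → y ∈ X := by
      intro y hy hyj
      by_contra h
      have := min'_le (a \ X) y (by simp [hy, h])
      omega
    -- there is an element of X \ a below j
    have hex : ∃ i ∈ X, i ∉ a ∧ i < j := by
      by_contra hcon
      push Not at hcon
      have h1 := hd (j + 1)
      rw [cnt_succ, cnt_succ, if_pos hja.1, if_neg hja.2] at h1
      have : cnt X j ≤ cnt a j := by
        unfold cnt
        apply card_le_card
        intro y hy
        rw [mem_filter] at hy ⊢
        refine ⟨?_, hy.2⟩
        by_contra h
        have := hcon y hy.1 h
        omega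
      omega
    classical
    obtain ⟨i, ⟨hiX, hia, hij⟩, hi_min⟩ : ∃ i, (i ∈ X ∧ i ∉ a ∧ i < j) ∧
        ∀ y, (y ∈ X ∧ y ∉ a ∧ y < j) → i ≤ y := by
      have hex' : ∃ i, i ∈ X ∧ i ∉ a ∧ i < j := hex
      exact ⟨Nat.find hex', Nat.find_spec hex', fun y hy => Nat.find_min' hex' hy⟩
    have hmem := hA a ha i (hX hiX) j (haW hja.1) hij hja.1 hia
    have hie : i ∉ a.erase j := by simp [hia]
    refine ih _ hmem ?_ ?_ ?_ ?_
    · have : insert i (a.erase j) \ X = (a \ X).erase j := by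
        ext y
        simp only [mem_sdiff, mem_insert, mem_erase]
        constructor
        · rintro ⟨h1 | h1, h2⟩
          · subst h1; exact absurd hiX h2
          · exact ⟨h1.1, h1.2, h2⟩
        · rintro ⟨h1, h2, h3⟩
          exact ⟨Or.inr ⟨h1, h2⟩, h3⟩
      rw [this, card_erase_of_mem (mem_sdiff.2 hja)]
      omega
    · exact insert_subset (hX hiX) ((erase_subset _ _).trans haW)
    · rw [card_insert_of_notMem hie, card_erase_of_mem hja.1]
      have := card_pos.2 ⟨j, hja.1⟩
      omega
    · intro t
      have e1 := cnt_insert hie t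
      have e2 := cnt_insert (notMem_erase j a) t
      rw [insert_erase hja.1] at e2
      have hdt := hd t
      by_cases hit : i < t
      · by_cases hjt : j < t
        · rw [if_pos hit] at e1; rw [if_pos hjt] at e2; omega
        · rw [if_pos hit] at e1; rw [if_neg hjt] at e2
          have : cnt a t + 1 ≤ cnt X t := by
            unfold cnt
            rw [← card_insert_of_notMem (s := a.filter (· < t)) (a := i) (by simp [hia])]
            apply card_le_card
            intro y hy
            rw [mem_insert, mem_filter] at hy
            rw [mem_filter]
            rcases hy with rfl | hy
            · exact ⟨hiX, hit⟩
            · exact ⟨hmin y hy.1 (by omega), hy.2⟩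
          omega
      · rw [if_neg hit] at e1
        split_ifs at e2 <;> omega

theorem crossX (W : Finset ℕ) (a b : ℕ) (G H : Finset (Finset ℕ)) (h : Cr W a b G H)
    (ha : 2 * a ≤ W.card) (hb : 2 * b ≤ W.card + 1) :
    G.card ≤ W.card.choose (W.card + 1 - a) ∨ H.card ≤ W.card.choose (W.card + 2 - b) := by
  classical
  obtain ⟨G', H', ⟨hC, hG, hH⟩, sG, sH⟩ := exists_shd W
    (fun A B => Cr W a b A B ∧ A.card = G.card ∧ B.card = H.card)
    (fun A B hAB i hi j hj hij => ⟨Cr_sh hAB.1 hi, by rw [card_sh]; exact hAB.2.1,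
      by rw [card_sh]; exact hAB.2.2⟩) _ G H rfl ⟨h, rfl, rfl⟩
  rw [← hG, ← hH]
  by_contra hcon
  push Not at hcon
  obtain ⟨h1, h2⟩ := hcon
  obtain ⟨hGs, hHs, hx⟩ := hC
  have hg : ∃ g ∈ G', ∀ j, 2 * cnt g j < cnt W j + 1 := by
    by_contra hc
    push Not at hc
    refine absurd (card_le_card (fun g hg => ?_) |>.trans (card_hit W a 1)) (not_le.2 h1)
    exact mem_filter.2 ⟨hGs hg, hc g hg⟩
  have hh : ∃ g ∈ H', ∀ j, 2 * cnt g j < cnt W j + 2 := by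
    by_contra hc
    push Not at hc
    refine absurd (card_le_card (fun g hg => ?_) |>.trans (card_hit W b 2)) (not_le.2 h2)
    exact mem_filter.2 ⟨hHs hg, hc g hg⟩
  obtain ⟨g, hg, hg'⟩ := hg
  obtain ⟨k, hk, hk'⟩ := hh
  have mg := mem_powersetCard.1 (hGs hg)
  have mk := mem_powersetCard.1 (hHs hk)
  let p : ℕ → Prop := fun c => c % 2 = 1 ∧ c < 2 * a
  let q : ℕ → Prop := fun c => c % 2 = 0 ∧ c < 2 * b
  let f : ℕ → ℕ := fun c => min a (c / 2)
  let f' : ℕ → ℕ := fun c => min b ((c + 1) / 2)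
  have fp : ∀ c, f (c + 1) = f c + if p c then 1 else 0 := by
    intro c; simp only [p, f]; split_ifs <;> omega
  have fq : ∀ c, f' (c + 1) = f' c + if q c then 1 else 0 := by
    intro c; simp only [q, f']; split_ifs <;> omega
  have P : rkset W p ∈ G' := by
    refine dom W G' sG _ (filter_subset _ _) _ g hg rfl mg.1 ?_ ?_
    · rw [card_rkset W p f (by simp [f]) fp, mg.2]; simp only [f]; omega
    · intro t
      rw [cnt_rkset W p f (by simp [f]) fp]
      have := hg' t
      have := cnt_le_card g t
      simp only [f]; omega
  have Q : rkset W q ∈ H' := by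
    refine dom W H' sH _ (filter_subset _ _) _ k hk rfl mk.1 ?_ ?_
    · rw [card_rkset W q f' (by simp [f']) fq, mk.2]; simp only [f']; omega
    · intro t
      rw [cnt_rkset W q f' (by simp [f']) fq]
      have := hk' t
      have := cnt_le_card k t
      simp only [f']; omega
  obtain ⟨w, hw⟩ := hx _ P _ Q
  simp only [rkset, mem_inter, mem_filter, p, q] at hw
  omega

/-- Splitting by an element. -/
theorem degree_add (A : Finset (Finset ℕ)) (z : ℕ) :
    degree A z + (A.filter fun a => z ∉ a).card = A.card :=
  card_filter_add_card_filter_not _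

theorem jumpL (W : Finset ℕ) (l : ℕ) (A B : Finset (Finset ℕ)) (h : Cr W l l A B)
    (hl : 2 ≤ l) (hm : 2 * l ≤ W.card) (z : ℕ) (hz : z ∈ W)
    (hB : (W.card - 1).choose (W.card + 1 - l) < degree B z) :
    (A.filter fun a => z ∉ a).card ≤ (W.card - 1).choose (W.card + 1 - l) := by
  obtain ⟨hA, hB', hx⟩ := h
  have hcW := card_erase_of_mem hz
  have := crossX (W.erase z) (l - 1) l ((B.filter fun b => z ∈ b).image (fun b => b.erase z))
    (A.filter fun a => z ∉ a) ⟨?_, ?_, ?_⟩ (by omega) (by omega)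
  · rw [card_image_of_injOn] at this
    · rw [hcW] at this
      have e1 : W.card - 1 + 1 - (l - 1) = W.card + 1 - l := by omega
      have e2 : W.card - 1 + 2 - l = W.card + 1 - l := by omega
      rw [e1, e2] at this
      rcases this with h | h
      · exact absurd h (not_le.2 hB)
      · exact h
    · intro x hx y hy hxy
      simp only [coe_filter, Set.mem_ofPred_eq] at hx hy
      have hxy' : x.erase z = y.erase z := hxy
      rw [← insert_erase hx.2, ← insert_erase hy.2, hxy']
  · intro x hx
    obtain ⟨y, hy, rfl⟩ := mem_image.1 hx
    rw [mem_filter] at hy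
    have := mem_powersetCard.1 (hB' hy.1)
    rw [mem_powersetCard]
    exact ⟨erase_subset_erase _ this.1, by rw [card_erase_of_mem hy.2, this.2]⟩
  · intro x hx
    rw [mem_filter] at hx
    have := mem_powersetCard.1 (hA hx.1)
    rw [mem_powersetCard]
    refine ⟨fun y hy => mem_erase.2 ⟨fun e => hx.2 (e ▸ hy), this.1 hy⟩, this.2⟩
  · intro x hx' y hy
    obtain ⟨b, hb, rfl⟩ := mem_image.1 hx'
    rw [mem_filter] at hb hy
    obtain ⟨w, hw⟩ := hx y hy.1 b hb.1
    rw [mem_inter] at hw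
    refine ⟨w, ?_⟩
    rw [mem_inter, mem_erase]
    exact ⟨⟨fun e => hy.2 (e ▸ hw.1), hw.2⟩, hw.1⟩

theorem Cr_symm {W : Finset ℕ} {a b : ℕ} {A B : Finset (Finset ℕ)} (h : Cr W a b A B) :
    Cr W b a B A :=
  ⟨h.2.1, h.1, fun x hx y hy => by rw [inter_comm]; exact h.2.2 y hy x hx⟩

theorem jump2 (W : Finset ℕ) (l D : ℕ) (A B : Finset (Finset ℕ)) (h : Cr W l l A B)
    (hl : 2 ≤ l) (hm : 2 * l ≤ W.card) (hA : D ≤ A.card) (hB : D ≤ B.card)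
    (hR : 3 * (W.card - 1).choose (W.card + 1 - l) < D) (z : ℕ) (hz : z ∈ W)
    (hd : (W.card - 1).choose (W.card + 1 - l) < degree B z ∨
      (W.card - 1).choose (W.card + 1 - l) < degree A z) :
    D ≤ degree A z + (W.card - 1).choose (W.card + 1 - l) ∧
    D ≤ degree B z + (W.card - 1).choose (W.card + 1 - l) := by
  have eA := degree_add A z
  have eB := degree_add B z
  have j1 := jumpL W l A B h hl hm z hz
  have j2 := jumpL W l B A (Cr_symm h) hl hm z hz
  rcases hd with hd | hd
  · have := j1 hd
    have := j2 (by omega)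
    omega
  · have := j2 hd
    have := j1 (by omega)
    omega

/-- The end state: a shifted cross-intersecting pair has a large degree. -/
theorem endE (W : Finset ℕ) (l D : ℕ) (A B : Finset (Finset ℕ)) (h : Cr W l l A B)
    (sA : Shd W A) (sB : Shd W B)
    (hl : 2 ≤ l) (hm : 2 * l ≤ W.card) (hA : D ≤ A.card) (hB : D ≤ B.card)
    (hR : 3 * (W.card - 1).choose (W.card + 1 - l) < D) :
    ∃ z ∈ W, (W.card - 1).choose (W.card + 1 - l) < degree B z ∨
      (W.card - 1).choose (W.card + 1 - l) < degree A z := by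
  classical
  have hne : W.Nonempty := card_pos.1 (by omega)
  set z := W.min' hne with hz
  have hzW : z ∈ W := min'_mem _ _
  have hzmin : ∀ y ∈ W, z ≤ y := fun y hy => min'_le _ _ hy
  refine ⟨z, hzW, ?_⟩
  by_contra hcon
  push Not at hcon
  have eA := degree_add A z
  have eB := degree_add B z
  have hcW := card_erase_of_mem hzW
  obtain ⟨hAs, hBs, hx⟩ := h
  have cW : ∀ j, cnt W j = cnt (W.erase z) j + if z < j then 1 else 0 := by
    intro j
    have := cnt_insert (notMem_erase z W) j
    rwa [insert_erase hzW] at this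
  have c0 : ∀ X ⊆ W, ∀ j, j ≤ z → cnt X j = 0 := by
    intro X hX j hj
    unfold cnt
    rw [card_eq_zero, filter_eq_empty_iff]
    intro y hy
    have := hzmin y (hX hy)
    omega
  have hmono : (W.card - 1).choose (W.card + 2 - l) ≤ (W.card - 1).choose (W.card + 1 - l) := by
    by_cases h2 : l = 2
    · rw [Nat.choose_eq_zero_of_lt (by omega)]; omega
    · rw [← Nat.choose_symm (by omega : W.card + 2 - l ≤ W.card - 1),
        ← Nat.choose_symm (by omega : W.card + 1 - l ≤ W.card - 1)]
      have e1 : W.card - 1 - (W.card + 2 - l) = l - 3 := by omega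
      have e2 : W.card - 1 - (W.card + 1 - l) = l - 3 + 1 := by omega
      rw [e1, e2]
      exact Nat.choose_le_succ_of_lt_half_left (by omega)
  have hg : ∃ g ∈ A, z ∉ g ∧ ∀ j, 2 * cnt g j < cnt (W.erase z) j + 2 := by
    by_contra hc
    push Not at hc
    have : (A.filter fun a => z ∉ a).card ≤ _ :=
      (card_le_card (fun g hg => ?_)).trans (card_hit (W.erase z) l 2)
    · rw [hcW] at this
      have e : W.card - 1 + 2 - l = W.card + 1 - l := by omega
      rw [e] at this
      omega
    · rw [mem_filter] at hg
      have := mem_powersetCard.1 (hAs hg.1)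
      refine mem_filter.2 ⟨mem_powersetCard.2 ⟨fun y hy => mem_erase.2
        ⟨fun e => hg.2 (e ▸ hy), this.1 hy⟩, this.2⟩, hc g hg.1 hg.2⟩
  have hh : ∃ g ∈ B, z ∉ g ∧ ∀ j, 2 * cnt g j < cnt (W.erase z) j + 3 := by
    by_contra hc
    push Not at hc
    have : (B.filter fun a => z ∉ a).card ≤ _ :=
      (card_le_card (fun g hg => ?_)).trans (card_hit (W.erase z) l 3)
    · rw [hcW] at this
      have e : W.card - 1 + 3 - l = W.card + 2 - l := by omega
      rw [e] at this
      omega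
    · rw [mem_filter] at hg
      have := mem_powersetCard.1 (hBs hg.1)
      refine mem_filter.2 ⟨mem_powersetCard.2 ⟨fun y hy => mem_erase.2
        ⟨fun e => hg.2 (e ▸ hy), this.1 hy⟩, this.2⟩, hc g hg.1 hg.2⟩
  obtain ⟨g, hg, hgz, hg'⟩ := hg
  obtain ⟨k, hk, hkz, hk'⟩ := hh
  have mg := mem_powersetCard.1 (hAs hg)
  have mk := mem_powersetCard.1 (hBs hk)
  have gsub : g ⊆ W.erase z := fun y hy => mem_erase.2 ⟨fun e => hgz (e ▸ hy), mg.1 hy⟩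
  have ksub : k ⊆ W.erase z := fun y hy => mem_erase.2 ⟨fun e => hkz (e ▸ hy), mk.1 hy⟩
  let p : ℕ → Prop := fun c => c = 0 ∨ (c % 2 = 1 ∧ 3 ≤ c ∧ c < 2 * l)
  let q : ℕ → Prop := fun c => c = 1 ∨ (c % 2 = 0 ∧ 2 ≤ c ∧ c < 2 * l - 1)
  let f : ℕ → ℕ := fun c => if c ≤ 1 then c else min l (c / 2)
  let f' : ℕ → ℕ := fun c => if c ≤ 1 then 0 else min l ((c + 1) / 2)
  have fp : ∀ c, f (c + 1) = f c + if p c then 1 else 0 := by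
    intro c; simp only [p, f]; split_ifs <;> omega
  have fq : ∀ c, f' (c + 1) = f' c + if q c then 1 else 0 := by
    intro c; simp only [q, f']; split_ifs <;> omega
  have P : rkset W p ∈ A := by
    refine dom W A sA _ (filter_subset _ _) _ g hg rfl mg.1 ?_ ?_
    · rw [card_rkset W p f (by simp [f]) fp, mg.2]; simp only [f]; split_ifs <;> omega
    · intro t
      rw [cnt_rkset W p f (by simp [f]) fp]
      have := hg' t
      have := cnt_le_card g t
      have := cW t
      have := c0 g mg.1 t
      have := c0 W subset_rfl t
      have := cnt_mono gsub t
      simp only [f]; split_ifs at * <;> omega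
  have Q : rkset W q ∈ B := by
    refine dom W B sB _ (filter_subset _ _) _ k hk rfl mk.1 ?_ ?_
    · rw [card_rkset W q f' (by simp [f']) fq, mk.2]; simp only [f']; split_ifs <;> omega
    · intro t
      rw [cnt_rkset W q f' (by simp [f']) fq]
      have := hk' t
      have := cnt_le_card k t
      have := cW t
      have := c0 k mk.1 t
      have := c0 W subset_rfl t
      have := cnt_mono ksub t
      simp only [f']; split_ifs at * <;> omega
  obtain ⟨w, hw⟩ := hx _ P _ Q
  simp only [rkset, mem_inter, mem_filter, p, q] at hw
  omega

theorem claimI (W : Finset ℕ) (l D : ℕ) (A B : Finset (Finset ℕ)) (h : Cr W l l A B)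
    (hl : 2 ≤ l) (hm : 2 * l ≤ W.card) (hA : D ≤ A.card) (hB : D ≤ B.card)
    (hR : 3 * (W.card - 1).choose (W.card + 1 - l) < D) :
    ∃ z ∈ W, D ≤ degree A z + (W.card - 1).choose (W.card + 1 - l) ∧
      D ≤ degree B z + (W.card - 1).choose (W.card + 1 - l) := by
  set R := (W.card - 1).choose (W.card + 1 - l) with hRdef
  by_contra hcon
  have hno : ∀ A B, Cr W l l A B → D ≤ A.card → D ≤ B.card →
      (∀ z ∈ W, ¬ (D ≤ degree A z + R ∧ D ≤ degree B z + R)) →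
      ∀ z, degree A z ≤ R ∧ degree B z ≤ R := by
    intro A B h hA hB hn z
    by_cases hz : z ∈ W
    · by_contra hc
      exact hn z hz (jump2 W l D A B h hl hm hA hB hR z hz (by omega))
    · have aux : ∀ A : Finset (Finset ℕ), A ⊆ powersetCard l W → degree A z = 0 := by
        intro A hA
        unfold degree
        rw [card_eq_zero, filter_eq_empty_iff]
        intro a ha hza
        exact hz ((mem_powersetCard.1 (hA ha)).1 hza)
      rw [aux A h.1, aux B h.2.1]; omega
  obtain ⟨A', B', ⟨hC, hA', hB', hn⟩, sA, sB⟩ := exists_shd W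
    (fun A B => Cr W l l A B ∧ D ≤ A.card ∧ D ≤ B.card ∧
      ∀ z ∈ W, ¬ (D ≤ degree A z + R ∧ D ≤ degree B z + R))
    (by
      rintro A B ⟨h, hA, hB, hn⟩ i hi j hj hij
      refine ⟨Cr_sh h hi, by rwa [card_sh], by rwa [card_sh], ?_⟩
      have hd := hno A B h hA hB hn
      intro z hz
      by_cases hzi : z = i
      · subst hzi
        have := degree_sh_i z j A
        have := hd z
        have := hd j
        omega
      · have := degree_sh i j A R (fun z _ => (hd z).1) z hzi
        omega) _ A B rfl ⟨h, hA, hB, fun z hz hh => hcon ⟨z, hz, hh⟩⟩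
  obtain ⟨z, hz, hh⟩ := endE W l D A' B' hC sA sB hl hm hA' hB' hR
  have := hno A' B' hC hA' hB' hn z
  omega

/-! ### Sections -/

def pt (F : Finset (Finset ℕ)) (S P : Finset ℕ) : Finset (Finset ℕ) :=
  F.filter fun a => ∀ s ∈ S, (s ∈ a ↔ s ∈ P)

def sec (F : Finset (Finset ℕ)) (S P : Finset ℕ) : Finset (Finset ℕ) :=
  (pt F S P).image (· \ S)

theorem pt_inter {F : Finset (Finset ℕ)} {S P a : Finset ℕ} (hP : P ⊆ S) (ha : a ∈ pt F S P) :
    a ∩ S = P := by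
  have h := (mem_filter.1 ha).2
  ext y
  rw [mem_inter]
  constructor
  · rintro ⟨h1, h2⟩; exact (h y h2).1 h1
  · intro h1; exact ⟨(h y (hP h1)).2 h1, hP h1⟩

theorem sec_inj {F : Finset (Finset ℕ)} {S P : Finset ℕ} (hP : P ⊆ S) :
    Set.InjOn (fun a : Finset ℕ => a \ S) (pt F S P) := by
  intro a ha b hb hab
  have hab' : a \ S = b \ S := hab
  rw [← sdiff_union_inter a S, ← sdiff_union_inter b S, hab', pt_inter hP ha, pt_inter hP hb]

theorem card_sec {F : Finset (Finset ℕ)} {S P : Finset ℕ} (hP : P ⊆ S) :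
    (sec F S P).card = (pt F S P).card := card_image_of_injOn (sec_inj hP)

theorem sec_sub {F : Finset (Finset ℕ)} {S P U : Finset ℕ} {k : ℕ} (hF : F ⊆ powersetCard k U)
    (hP : P ⊆ S) : sec F S P ⊆ powersetCard (k - P.card) (U \ S) := by
  intro x hx
  obtain ⟨a, ha, rfl⟩ := mem_image.1 hx
  have h1 := mem_powersetCard.1 (hF (mem_filter.1 ha).1)
  rw [mem_powersetCard]
  refine ⟨sdiff_subset_sdiff h1.1 subset_rfl, ?_⟩
  have := card_sdiff_add_card_inter a S
  rw [pt_inter hP ha] at this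
  omega

theorem sec_card_le {F : Finset (Finset ℕ)} {S P U : Finset ℕ} {k : ℕ}
    (hF : F ⊆ powersetCard k U) (hP : P ⊆ S) (hS : S ⊆ U) :
    (pt F S P).card ≤ (U.card - S.card).choose (k - P.card) := by
  rw [← card_sec hP]
  refine (card_le_card (sec_sub hF hP)).trans ?_
  rw [card_powersetCard, card_sdiff_of_subset hS]

theorem sec_Cr {F : Finset (Finset ℕ)} {S P Q U : Finset ℕ} {k : ℕ} (hF : F ⊆ powersetCard k U)
    (hint : ∀ A ∈ F, ∀ B ∈ F, (A ∩ B).Nonempty) (hP : P ⊆ S) (hQ : Q ⊆ S) (hd : Disjoint P Q) :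
    Cr (U \ S) (k - P.card) (k - Q.card) (sec F S P) (sec F S Q) := by
  refine ⟨sec_sub hF hP, sec_sub hF hQ, ?_⟩
  intro x hx y hy
  obtain ⟨a, ha, rfl⟩ := mem_image.1 hx
  obtain ⟨b, hb, rfl⟩ := mem_image.1 hy
  obtain ⟨w, hw⟩ := hint a (mem_filter.1 ha).1 b (mem_filter.1 hb).1
  rw [mem_inter] at hw
  have hwS : w ∉ S := by
    intro h
    exact disjoint_left.1 hd (((mem_filter.1 ha).2 w h).1 hw.1) (((mem_filter.1 hb).2 w h).1 hw.2)
  exact ⟨w, by simp [hw.1, hw.2, hwS]⟩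

theorem degree_sec {F : Finset (Finset ℕ)} {S P : Finset ℕ} {z : ℕ} (hz : z ∉ S) :
    degree (sec F S P) z ≤ ((pt F S P).filter fun a => z ∈ a).card := by
  unfold degree sec
  rw [filter_image]
  refine card_image_le.trans (card_le_card ?_)
  intro a
  simp only [mem_filter, mem_sdiff]
  rintro ⟨h1, h2, _⟩
  exact ⟨h1, h2⟩

theorem arith (M j : ℕ) (hM : 2 * j + 2 ≤ M) (h : 5 * M.choose j ≤ (M + 2).choose (j + 1)) :
    3 * (M + 1).choose j < 5 * M.choose j ∧ 2 * j + 3 ≤ M := by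
  have h1 := Nat.choose_mul_succ_eq M j
  have h2 := Nat.add_one_mul_choose_eq (M + 1) j
  have hT : 0 < M.choose j := Nat.choose_pos (by omega)
  obtain ⟨d, hd⟩ : ∃ d, M + 1 - j = d := ⟨_, rfl⟩
  have hMd : M + 1 = d + j := by omega
  rw [hd] at h1
  generalize M.choose j = T at *
  generalize (M + 1).choose j = R at *
  generalize (M + 1 + 1).choose (j + 1) = V at *
  have h3 : 5 * T * (j + 1) * d ≤ (M + 2) * (M + 1) * T := by
    calc 5 * T * (j + 1) * d ≤ V * (j + 1) * d := by gcongr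
      _ = (M + 2) * (R * d) := by rw [← h2]; ring
      _ = _ := by rw [← h1]; ring
  have h4 : 5 * (j + 1) * d ≤ (M + 2) * (M + 1) := by
    refine Nat.le_of_mul_le_mul_right (c := T) ?_ hT
    linarith
  have hd' : j + 3 ≤ d := by omega
  rw [hMd, show M + 2 = d + j + 1 by omega] at h4
  constructor
  · by_contra hc
    push Not at hc
    have h5 : 5 * d * T ≤ 3 * (M + 1) * T := by
      calc 5 * d * T = 5 * T * d := by ring
        _ ≤ 3 * R * d := by gcongr
        _ = 3 * (R * d) := by ring
        _ = _ := by rw [← h1]; ring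
    have h6 : 5 * d ≤ 3 * (M + 1) := Nat.le_of_mul_le_mul_right h5 hT
    rw [hMd] at h6
    have : 2 * d ≤ 3 * j := by omega
    nlinarith
  · by_contra hc
    have : d = j + 3 := by omega
    subst this
    nlinarith

theorem nth_one (n : ℕ) (F : Finset (Finset ℕ)) (z : ℕ) (hz : z ∈ Icc 1 n) :
    degree F z ≤ nthDegree n F 1 := by
  unfold nthDegree
  set m := (Icc 1 n).val.map (degree F) with hm
  have hs : (m.sort (· ≥ ·)).Pairwise (· ≥ ·) := Multiset.pairwise_sort _ _
  have hmem : degree F z ∈ m.sort (· ≥ ·) := by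
    rw [Multiset.mem_sort, hm]
    exact Multiset.mem_map_of_mem _ hz
  cases hL : m.sort (· ≥ ·) with
  | nil => rw [hL] at hmem; simp at hmem
  | cons a L =>
    rw [hL] at hs hmem
    simp only [Nat.sub_self, List.getD_cons_zero]
    rcases List.mem_cons.1 hmem with h | h
    · exact h.le
    · exact (List.pairwise_cons.1 hs).1 _ h

theorem nth_four (n D : ℕ) (F : Finset (Finset ℕ)) (h : D < nthDegree n F 4) :
    4 ≤ ((Icc 1 n).filter fun x => D < degree F x).card := by
  unfold nthDegree at h
  set m := (Icc 1 n).val.map (degree F) with hm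
  have hs : (m.sort (· ≥ ·)).Pairwise (· ≥ ·) := Multiset.pairwise_sort _ _
  have hc : ((Icc 1 n).filter fun x => D < degree F x).card
      = ((m.sort (· ≥ ·)).filter (fun y => D < y)).length := by
    have e : ((m.sort (· ≥ ·) : List ℕ) : Multiset ℕ) = m := Multiset.sort_eq _ _
    rw [← Multiset.coe_card, ← Multiset.filter_coe, e, hm, Multiset.filter_map, Multiset.card_map]
    rfl
  rw [hc]
  generalize m.sort (· ≥ ·) = L at *
  match L, hs, h with
  | a :: b :: c :: d :: L, hs, h =>
    simp only [List.pairwise_cons, List.mem_cons, forall_eq_or_imp] at hs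
    have h' : D < d := by simpa using h
    have h1 : D < a := by omega
    have h2 : D < b := by omega
    have h3 : D < c := by omega
    simp [List.filter_cons, h', h1, h2, h3]
  | [], _, h => simp at h
  | [a], _, h => simp at h
  | [a, b], _, h => simp at h
  | [a, b, c], _, h => simp at h

/-- The counting inequalities for four distinct points. -/
theorem count4 (F : Finset (Finset ℕ)) (u v z x : ℕ) (huv : v ≠ u) (hzu : z ≠ u) (hzv : z ≠ v)
    (hxu : x ≠ u) (hxv : x ≠ v) (hxz : x ≠ z) :
    let N := fun P : Finset ℕ => (pt F {u, v, z, x} P).card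
    degree F x ≤ N {x} + N {u, x} + N {v, x} + N {z, x} + (pt F {u, v, x} {u, v, x}).card
      + N {u, z, x} + N {v, z, x} ∧
    ((pt F {u, v} {u}).filter fun a => z ∈ a).card ≤ N {u, z} + N {u, z, x} ∧
    ((pt F {u, v} {v}).filter fun a => z ∈ a).card ≤ N {v, z} + N {v, z, x} ∧
    degree F u + N {v, z} + N {z, x} ≤
      degree F z + N {u} + N {u, v} + N {u, x} + N {u, v, x} := by
  intro N
  simp only [N, degree, pt, filter_filter]
  refine ⟨?_, ?_, ?_, ?_⟩
  all_goals
    simp only [card_filter, ← sum_add_distrib]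
    apply sum_le_sum
    intro a _
    by_cases h1 : u ∈ a <;> by_cases h2 : v ∈ a <;> by_cases h3 : z ∈ a <;> by_cases h4 : x ∈ a <;>
    simp [h1, h2, h3, h4, huv, hzu, hzv, hxu, hxv, hxz, huv.symm, hzu.symm, hzv.symm, hxu.symm,
      hxv.symm, hxz.symm]

theorem count2 (F : Finset (Finset ℕ)) (u v : ℕ) (huv : v ≠ u) (h : degree F v ≤ degree F u) :
    (pt F {u, v} {v}).card ≤ (pt F {u, v} {u}).card ∧
    (F.filter fun A => v ∈ A ∧ u ∉ A).card ≤ (pt F {u, v} {v}).card := by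
  have : degree F u + (pt F {u, v} {v}).card ≤ degree F v + (pt F {u, v} {u}).card := by
    simp only [degree, pt]
    simp only [card_filter, ← sum_add_distrib]
    apply sum_le_sum
    intro a _
    by_cases h1 : u ∈ a <;> by_cases h2 : v ∈ a <;> simp [h1, h2, huv, huv.symm]
  refine ⟨by omega, ?_⟩
  apply card_le_card
  intro a
  simp only [pt, mem_filter]
  rintro ⟨h1, h2, h3⟩
  refine ⟨h1, ?_⟩
  simp [h2, h3, huv.symm]

theorem stmt_16 (n k : ℕ) (hk : 3 ≤ k) (hn : 2 * k ≤ n)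
    (F : Finset (Finset ℕ)) (hF : F ⊆ Finset.powersetCard k (Finset.Icc 1 n))
    (hint : ∀ A ∈ F, ∀ B ∈ F, (A ∩ B).Nonempty)
    (u : ℕ) (hu : u ∈ Finset.Icc 1 n) (hdu : degree F u = nthDegree n F 1)
    (v : ℕ) (hv : v ∈ Finset.Icc 1 n) (hvu : v ≠ u)
    (hbar : 5 * (n - 4).choose (k - 3) ≤ (F.filter fun A => v ∈ A ∧ u ∉ A).card) :
    nthDegree n F 4 ≤ 6 * (n - 3).choose (k - 3) := by
  by_contra hcon
  push Not at hcon
  have h4 := nth_four _ _ _ hcon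
  have hmax : ∀ z ∈ Icc 1 n, degree F z ≤ degree F u := fun z hz => hdu ▸ nth_one n F z hz
  obtain ⟨j, rfl⟩ : ∃ j, k = j + 3 := ⟨k - 3, by omega⟩
  obtain ⟨M, rfl⟩ : ∃ M, n = M + 4 := ⟨n - 4, by omega⟩
  have hU : (Icc 1 (M + 4)).card = M + 4 := by simp
  simp only [Nat.add_sub_cancel, show M + 4 - 3 = M + 1 by omega] at *
  generalize hUd : Icc 1 (M + 4) = U at *
  obtain ⟨hAB, hB⟩ := count2 F u v hvu (hmax v hv)
  have s1 : ({u} : Finset ℕ) ⊆ {u, v} := by simp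
  have s2 : ({v} : Finset ℕ) ⊆ {u, v} := by simp
  have sUV : ({u, v} : Finset ℕ) ⊆ U := by
    intro y; simp only [mem_insert, mem_singleton]; rintro (rfl | rfl) <;> assumption
  have hC := sec_Cr hF hint s1 s2 (by simp [hvu.symm])
  have hW : (U \ {u, v}).card = M + 2 := by
    rw [card_sdiff_of_subset sUV, card_pair hvu.symm, hU]; omega
  simp only [card_singleton, show j + 3 - 1 = j + 2 by omega] at hC
  have cA := card_sec (F := F) s1
  have cB := card_sec (F := F) s2
  have hx1 := crossX _ _ _ _ _ hC (by omega) (by omega)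
  rw [hW, show M + 2 + 1 - (j + 2) = M + 1 - j by omega,
    show M + 2 + 2 - (j + 2) = M + 2 - j by omega,
    Nat.choose_symm_of_eq_add (show M + 2 = M + 1 - j + (j + 1) by omega),
    Nat.choose_symm_of_eq_add (show M + 2 = M + 2 - j + j by omega)] at hx1
  have hle : (M + 2).choose j ≤ (M + 2).choose (j + 1) :=
    Nat.choose_le_succ_of_lt_half_left (by omega)
  obtain ⟨hR, hM⟩ := arith M j (by omega) (by omega)
  have hRe : (M + 1).choose (M + 1 - j) = (M + 1).choose j := Nat.choose_symm (by omega)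
  have hTe : M.choose (M - j) = M.choose j := Nat.choose_symm (by omega)
  obtain ⟨z, hz, hzA, hzB⟩ := claimI _ _ (5 * M.choose j) _ _ hC (by omega) (by omega) (by omega)
    (by omega) (by
      rw [hW, show M + 2 + 1 - (j + 2) = M + 1 - j by omega, show M + 2 - 1 = M + 1 by omega, hRe]
      exact hR)
  rw [hW, show M + 2 + 1 - (j + 2) = M + 1 - j by omega, show M + 2 - 1 = M + 1 by omega, hRe]
    at hzA hzB
  rw [mem_sdiff] at hz
  obtain ⟨hzU, hz2⟩ := hz
  have hzA' := degree_sec (F := F) (P := {u}) hz2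
  have hzB' := degree_sec (F := F) (P := {v}) hz2
  simp only [mem_insert, mem_singleton, not_or] at hz2
  obtain ⟨x, hx, hx3⟩ : ∃ x ∈ U.filter (fun x => 6 * (M + 1).choose j < degree F x),
      x ∉ ({u, v, z} : Finset ℕ) := by
    apply exists_mem_notMem_of_card_lt_card
    exact lt_of_le_of_lt card_le_three (by omega)
  rw [mem_filter] at hx
  obtain ⟨hxU, hxd⟩ := hx
  simp only [mem_insert, mem_singleton, not_or] at hx3
  obtain ⟨hxu, hxv, hxz⟩ := hx3
  obtain ⟨hzu, hzv⟩ := hz2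
  obtain ⟨c1, c2, c3, c4⟩ := count4 F u v z x hvu hzu hzv hxu hxv hxz
  beta_reduce at c1 c2 c3 c4
  have hzmax := hmax z hzU
  -- sizes
  have sS : ({u, v, z, x} : Finset ℕ) ⊆ U := by
    intro y; simp only [mem_insert, mem_singleton]; rintro (rfl | rfl | rfl | rfl) <;> assumption
  have sS3 : ({u, v, x} : Finset ℕ) ⊆ U := by
    intro y; simp only [mem_insert, mem_singleton]; rintro (rfl | rfl | rfl) <;> assumption
  have cS : ({u, v, z, x} : Finset ℕ).card = 4 := by
    rw [card_insert_of_notMem (by simp; grind), card_insert_of_notMem (by simp; grind),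
      card_pair (Ne.symm hxz)]
  have c3' : ∀ a b c : ℕ, a ≠ b → a ≠ c → b ≠ c → ({a, b, c} : Finset ℕ).card = 3 :=
    fun a b c h1 h2 h3 => card_eq_three.2 ⟨a, b, c, h1, h2, h3, rfl⟩
  have hW4 : (U \ {u, v, z, x}).card = M := by
    rw [card_sdiff_of_subset sS, cS, hU]; omega
  have t0 : (pt F {u, v, x} {u, v, x}).card ≤ (M + 1).choose j := by
    have := sec_card_le hF (subset_refl ({u, v, x} : Finset ℕ)) sS3
    rw [c3' u v x hvu.symm (Ne.symm hxu) (Ne.symm hxv), hU] at this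
    exact this
  have tt : ∀ a b c : ℕ, a ≠ b → a ≠ c → b ≠ c → ({a, b, c} : Finset ℕ) ⊆ {u, v, z, x} →
      (pt F {u, v, z, x} {a, b, c}).card ≤ M.choose j := by
    intro a b c h1 h2 h3 hs
    have := sec_card_le hF hs sS
    rw [c3' a b c h1 h2 h3, hU, cS] at this
    exact this
  have t1 := tt u z x (Ne.symm hzu) (Ne.symm hxu) (Ne.symm hxz) (by grind)
  have t2 := tt v z x (Ne.symm hzv) (Ne.symm hxv) (Ne.symm hxz) (by grind)
  have t3 := tt u v x hvu.symm (Ne.symm hxu) (Ne.symm hxv) (by grind)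
  have hRTS : (M + 1).choose j = M.choose j + M.choose (M + 1 - j) := by
    rw [← hRe, show M + 1 - j = M - j + 1 by omega, Nat.choose_succ_succ, hTe]
  have pp : ∀ a b c d : ℕ, a ≠ b → c ≠ d → Disjoint ({a, b} : Finset ℕ) {c, d} →
      ({a, b} : Finset ℕ) ⊆ {u, v, z, x} → ({c, d} : Finset ℕ) ⊆ {u, v, z, x} →
      M.choose j < (pt F {u, v, z, x} {a, b}).card →
      (pt F {u, v, z, x} {c, d}).card ≤ M.choose (M + 1 - j) := by
    intro a b c d h1 h2 hd hs1 hs2 hlt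
    have hC := sec_Cr hF hint hs1 hs2 hd
    rw [card_pair h1, card_pair h2] at hC
    have := crossX _ _ _ _ _ hC (by omega) (by omega)
    rw [card_sec hs1, card_sec hs2, hW4, show M + 1 - (j + 3 - 2) = M - j by omega, hTe,
      show M + 2 - (j + 3 - 2) = M + 1 - j by omega] at this
    omega
  have ps : ∀ a b c : ℕ, a ≠ b → Disjoint ({a, b} : Finset ℕ) {c} →
      ({a, b} : Finset ℕ) ⊆ {u, v, z, x} → ({c} : Finset ℕ) ⊆ {u, v, z, x} →
      M.choose j < (pt F {u, v, z, x} {a, b}).card →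
      (pt F {u, v, z, x} {c}).card ≤ M.choose j := by
    intro a b c h1 hd hs1 hs2 hlt
    have hC := sec_Cr hF hint hs1 hs2 hd
    rw [card_pair h1, card_singleton] at hC
    have := crossX _ _ _ _ _ hC (by omega) (by omega)
    rw [card_sec hs1, card_sec hs2, hW4, show M + 1 - (j + 3 - 2) = M - j by omega, hTe,
      show M + 2 - (j + 3 - 1) = M - j by omega, hTe] at this
    omega
  have q1 := pp u z v x (Ne.symm hzu) (Ne.symm hxv) (by simp; grind) (by grind) (by grind) (by omega)
  have q2 := pp v z u x (Ne.symm hzv) (Ne.symm hxu) (by simp; grind) (by grind) (by grind) (by omega)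
  have q3 := ps u z x (Ne.symm hzu) (by simp; grind) (by grind) (by grind) (by omega)
  have q4 := pp z x u v (Ne.symm hxz) hvu.symm (by simp; grind) (by grind) (by grind) (by omega)
  have q5 := ps z x u (Ne.symm hxz) (by simp; grind) (by grind) (by grind) (by omega)
  omega
end

section
/- Let k ≥ 3 and n > 2k, and let F ⊆ \binom{[n]}{k} be an intersecting family. Then either d_{2k+1}(F) ≤ \binom{n-2}{k-2} or |F| ≤ \binom{n-2}{k-2} + 2·\binom{n-3}{k-2}. -/
open Finset

open scoped FinsetFamily

theorem nm_count_gen {α : Type*} [DecidableEq α] (a b : ℕ) (V : Finset α)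
    (B T : Finset (Finset α)) (hB : B ⊆ powersetCard b V)
    (hT : ∀ S ∈ B, ∀ t, t ⊆ S → #t = a → t ∈ T) :
    #B * b.choose a ≤ #T * (#V - a).choose (b - a) := by
  classical
  have h1 : #B * b.choose a ≤ #(T ∩ powersetCard a V) * (#V - a).choose (b - a) := by
    apply card_mul_le_card_mul (fun S t => t ⊆ S)
    · intro S hS
      have hS' := mem_powersetCard.1 (hB hS)
      rw [← hS'.2, ← card_powersetCard]
      apply card_le_card
      intro t ht
      rw [mem_powersetCard] at ht
      simp only [mem_bipartiteAbove, mem_inter, mem_powersetCard]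
      exact ⟨⟨hT S hS t ht.1 ht.2, ht.1.trans hS'.1, ht.2⟩, ht.1⟩
    · intro t ht
      simp only [mem_inter, mem_powersetCard] at ht
      have : #(V \ t) = #V - a := by
        rw [card_sdiff_of_subset ht.2.1, ht.2.2]
      rw [← this, ← card_powersetCard]
      apply card_le_card_of_injOn (fun S => S \ t)
      · intro S hS
        simp only [coe_bipartiteBelow, Set.mem_ofPred_eq] at hS
        have hS' := mem_powersetCard.1 (hB hS.1)
        simp only [mem_coe, mem_powersetCard]
        refine ⟨sdiff_subset_sdiff hS'.1 le_rfl, ?_⟩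
        rw [card_sdiff_of_subset hS.2, hS'.2, ht.2.2]
      · intro S hS S' hS' h
        simp only [coe_bipartiteBelow, Set.mem_ofPred_eq] at hS hS'
        simp only at h
        rw [← sdiff_union_of_subset hS.2, h, sdiff_union_of_subset hS'.2]
  exact h1.trans (Nat.mul_le_mul_right _ (card_le_card inter_subset_left))

theorem nm_count {α : Type*} [DecidableEq α] (a b : ℕ) (hab : a ≤ b) (V : Finset α) (hV : #V = a + b)
    (B T : Finset (Finset α)) (hB : B ⊆ powersetCard b V)
    (hT : ∀ S ∈ B, ∀ t, t ⊆ S → #t = a → t ∈ T) : #B ≤ #T := by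
  have h1 := nm_count_gen a b V B T hB hT
  rw [hV, Nat.add_sub_cancel_left, Nat.choose_symm hab] at h1
  exact Nat.le_of_mul_le_mul_right h1 (Nat.choose_pos hab)

theorem exists_init (N r q : ℕ) (hq : q ≤ N.choose r) :
    ∃ C : Finset (Finset (Fin N)), Colex.IsInitSeg C r ∧ #C = q := by
  classical
  induction q with
  | zero => exact ⟨∅, Colex.isInitSeg_empty, rfl⟩
  | succ q ih =>
    obtain ⟨C, hC, hCq⟩ := ih (by omega)
    have hne : (((powersetCard r (univ : Finset (Fin N))) \ C).image toColex).Nonempty := by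
      rw [image_nonempty, ← card_pos]
      have := le_card_sdiff C (powersetCard r (univ : Finset (Fin N)))
      rw [card_powersetCard, card_univ, Fintype.card_fin] at this
      omega
    obtain ⟨m, hm, hmin⟩ := exists_min_image _ id hne
    rw [mem_image] at hm
    obtain ⟨s, hs, rfl⟩ := hm
    rw [mem_sdiff, mem_powersetCard] at hs
    refine ⟨insert s C, ⟨?_, ?_⟩, by rw [card_insert_of_notMem hs.2, hCq]⟩
    · intro t ht
      simp only [coe_insert, Set.mem_insert_iff, mem_coe] at ht
      rcases ht with rfl | ht
      · exact hs.1.2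
      · exact hC.1 ht
    · intro u t hu ht
      rw [mem_insert] at hu
      rcases hu with rfl | hu
      · by_contra hcon
        have htC : t ∉ C := fun h => hcon (mem_insert_of_mem h)
        have := hmin (toColex t) (mem_image_of_mem _ (by
          rw [mem_sdiff, mem_powersetCard]; exact ⟨⟨subset_univ _, ht.2⟩, htC⟩))
        exact absurd ht.1 (not_lt.2 this)
      · exact mem_insert_of_mem (hC.2 hu ht)

theorem init_low (N r M : ℕ) :
    Colex.IsInitSeg (powersetCard r (univ.filter fun x : Fin N => x.val < M)) r := by
  refine ⟨Set.sized_powersetCard _ _, ?_⟩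
  simp_rw [mem_powersetCard]
  rintro A B hA ⟨HB₁, HB₂⟩
  refine ⟨fun t ht ↦ ?_, ‹_›⟩
  rw [mem_filter]
  refine ⟨mem_univ _, ?_⟩
  have : toColex (image Fin.val B) < toColex (image Fin.val A) := by
    rwa [Colex.toColex_image_lt_toColex_image Fin.val_strictMono]
  apply Colex.forall_lt_mono this.le _ t (mem_image.2 ⟨t, ht, rfl⟩)
  simp_rw [mem_image]
  rintro _ ⟨a, ha, rfl⟩
  exact (mem_filter.1 (hA.1 ha)).2

theorem card_low (N M : ℕ) (h : M ≤ N) : #(univ.filter fun x : Fin N => x.val < M) = M := by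
  rw [Fin.card_filter_val_lt]; omega

/-- If one initial segment is at most as large as another one, it is contained in it. -/
theorem init_sub {N r : ℕ} {C D : Finset (Finset (Fin N))} (hC : Colex.IsInitSeg C r)
    (hD : Colex.IsInitSeg D r) (h : #C ≤ #D) : C ⊆ D := by
  rcases hC.total hD with h1 | h1
  · exact h1
  · rw [eq_of_subset_of_card_le h1 h]

theorem cross_kk {N a b : ℕ} (hab : a + b ≤ N) (A B C : Finset (Finset (Fin N)))
    (hA : ∀ S ∈ A, #S = a) (hB : ∀ S ∈ B, #S = b) (hc : ∀ S ∈ A, ∀ T ∈ B, (S ∩ T).Nonempty)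
    (hC : Colex.IsInitSeg C (N - b)) (hCB : #C ≤ #B) :
    #A + #(∂^[N - b - a] C) ≤ N.choose a := by
  classical
  set B' := B.image compl with hB'
  have hsz : (B' : Set (Finset (Fin N))).Sized (N - b) := by
    intro S hS
    rw [hB', mem_coe, mem_image] at hS
    obtain ⟨T, hT, rfl⟩ := hS
    rw [card_compl, hB T hT, Fintype.card_fin]
  have hcard : #B' = #B := card_image_of_injective _ compl_injective
  have h1 := iterated_kk (k := N - b - a) hsz (by rw [hcard]; exact hCB) hC
  have hdisj : Disjoint A (∂^[N - b - a] B') := by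
    rw [disjoint_left]
    intro S hS hS'
    rw [mem_shadow_iterate_iff_exists_card] at hS'
    obtain ⟨u, -, -, h⟩ := hS'
    rw [hB', mem_image] at h
    obtain ⟨T, hT, h⟩ := h
    obtain ⟨x, hx⟩ := hc S hS T hT
    rw [mem_inter] at hx
    have : x ∈ Tᶜ := by rw [h]; exact mem_union_left _ hx.1
    exact (mem_compl.1 this) hx.2
  have h2 : A ∪ ∂^[N - b - a] B' ⊆ powersetCard a univ := by
    intro S hS
    rw [mem_powersetCard]
    refine ⟨subset_univ _, ?_⟩
    rcases mem_union.1 hS with h | h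
    · exact hA S h
    · rw [(hsz.shadow_iterate) h]; omega
  have h3 := card_le_card h2
  rw [card_union_of_disjoint hdisj, card_powersetCard, card_univ, Fintype.card_fin] at h3
  omega

theorem fin_i {N a b : ℕ} (M : ℕ) (hab : a + b ≤ N) (hM : M ≤ N) (hbM : N - b ≤ M)
    (A B : Finset (Finset (Fin N)))
    (hA : ∀ S ∈ A, #S = a) (hB : ∀ S ∈ B, #S = b) (hc : ∀ S ∈ A, ∀ T ∈ B, (S ∩ T).Nonempty)
    (hBM : M.choose (N - b) ≤ #B) : #A + M.choose a ≤ N.choose a := by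
  have hl := init_low N (N - b) M
  have h1 := cross_kk hab A B _ hA hB hc hl (by rw [card_powersetCard, card_low N M hM]; exact hBM)
  have h2 := kruskal_katona_lovasz_form (i := N - b - a) (by omega) hbM hM hl.1
    (by rw [card_powersetCard, card_low N M hM])
  rw [show N - b - (N - b - a) = a by omega] at h2
  omega

theorem fin_ii {N a b : ℕ} (hab : a + b ≤ N) (hab' : a ≤ b)
    (A B : Finset (Finset (Fin N)))
    (hA : ∀ S ∈ A, #S = a) (hB : ∀ S ∈ B, #S = b) (hc : ∀ S ∈ A, ∀ T ∈ B, (S ∩ T).Nonempty)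
    (hBM : #B ≤ (a + (N - b)).choose a) : #A + #B ≤ N.choose a := by
  classical
  have hBM' : #B ≤ (a + (N - b)).choose (N - b) := by
    rw [Nat.choose_symm_add] at hBM; exact hBM
  obtain ⟨C, hC, hCB⟩ := exists_init N (N - b) #B (hBM'.trans (Nat.choose_le_choose _ (by omega)))
  have h1 := cross_kk hab A B _ hA hB hc hC hCB.le
  have hl := init_low N (N - b) (a + (N - b))
  have hcl := card_low N (a + (N - b)) (by omega)
  have hsub := init_sub hC hl (by rw [card_powersetCard, hcl, hCB]; exact hBM')
  have h2 := nm_count a (N - b) (by omega) _ hcl C (∂^[N - b - a] C) hsub (by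
    intro S hS t ht hta
    rw [mem_shadow_iterate_iff_exists_mem_card_add]
    refine ⟨S, hS, ht, ?_⟩
    rw [hC.1 hS, hta]; omega)
  omega

theorem fin_iii {N l : ℕ} (hl2 : 2 ≤ l) (hN : 2 * l ≤ N)
    (A B : Finset (Finset (Fin N)))
    (hA : ∀ S ∈ A, #S = l) (hB : ∀ S ∈ B, #S = l) (hc : ∀ S ∈ A, ∀ T ∈ B, (S ∩ T).Nonempty)
    (hB1 : (N - 2).choose (l - 2) ≤ #B) (hB2 : #B ≤ (N - 1).choose (l - 1)) :
    #A + #B ≤ 2 * (N - 1).choose (l - 1) := by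
  classical
  have hs2 : (N - 2).choose (l - 2) = (N - 2).choose (N - l) := by
    rw [← Nat.choose_symm (by omega)]; congr 1; omega
  have hs1 : (N - 1).choose (l - 1) = (N - 1).choose (N - l) := by
    rw [← Nat.choose_symm (by omega)]; congr 1; omega
  obtain ⟨C, hC, hCB⟩ := exists_init N (N - l) #B
    (by rw [hs1] at hB2; exact hB2.trans (Nat.choose_le_choose _ (by omega)))
  have h1 := cross_kk (by omega) A B _ hA hB hc hC hCB.le
  have hc1 := card_low N (N - 1) (by omega)
  have hc2 := card_low N (N - 2) (by omega)
  have hsub1 := init_sub hC (init_low N (N - l) (N - 1))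
    (by rw [card_powersetCard, hc1, hCB, ← hs1]; exact hB2)
  have hsub2 := init_sub (init_low N (N - l) (N - 2)) hC
    (by rw [card_powersetCard, hc2, hCB, ← hs2]; exact hB1)
  set V := univ.filter fun x : Fin N => x.val < N - 2 with hV
  set W := univ.filter fun x : Fin N => x.val < N - 1 with hW
  set p : Fin N := ⟨N - 2, by omega⟩ with hp
  have hpV : p ∉ V := by simp [hV, hp]
  have hWV : ∀ x ∈ W, x ≠ p → x ∈ V := by
    intro x hx hxp
    simp only [hW, hV, mem_filter, mem_univ, true_and] at hx ⊢
    have : x.val ≠ N - 2 := fun h => hxp (Fin.ext h)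
    omega
  -- the part of `C` containing `p`
  set Y := (C.filter fun S => p ∈ S).image (fun S => S.erase p) with hY
  have hYcard : #Y = #(C.filter fun S => p ∈ S) := by
    apply card_image_of_injOn
    intro S hS S' hS' h
    simp only [coe_filter, Set.mem_ofPred_eq] at hS hS'
    simp only at h
    rw [← insert_erase hS.2, h, insert_erase hS'.2]
  have hYsub : Y ⊆ powersetCard (N - l - 1) V := by
    intro S hS
    rw [hY, mem_image] at hS
    obtain ⟨T, hT, rfl⟩ := hS
    rw [mem_filter] at hT
    rw [mem_powersetCard]
    constructor
    · intro x hx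
      rw [mem_erase] at hx
      exact hWV x ((mem_powersetCard.1 (hsub1 hT.1)).1 hx.2) hx.1
    · rw [card_erase_of_mem hT.2, hC.1 hT.1]
  have hCsplit : #C ≤ (N - 2).choose (l - 2) + #Y := by
    rw [hYcard, ← card_filter_add_card_filter_not (s := C) (fun S => p ∈ S), add_comm, hs2]
    apply Nat.add_le_add_right
    rw [← hc2, ← card_powersetCard]
    apply card_le_card
    intro S hS
    rw [mem_filter] at hS
    have := mem_powersetCard.1 (hsub1 hS.1)
    rw [mem_powersetCard]
    exact ⟨fun x hx => hWV x (this.1 hx) (fun h => hS.2 (h ▸ hx)), this.2⟩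
  set Sh := ∂^[N - l - l] C with hSh
  have hmem : ∀ t : Finset (Fin N), #t = l → ∀ S ∈ C, t ⊆ S → t ∈ Sh := by
    intro t ht S hS hts
    rw [hSh, mem_shadow_iterate_iff_exists_mem_card_add]
    refine ⟨S, hS, hts, ?_⟩
    rw [hC.1 hS, ht]; omega
  have hYle : #Y ≤ #(Sh.filter fun S => p ∈ S) := by
    have := nm_count (l - 1) (N - l - 1) (by omega) V (by rw [hc2]; omega) Y
      ((Sh.filter fun S => p ∈ S).image (fun S => S.erase p)) hYsub (by
        intro S hS t hts hta
        rw [hY, mem_image] at hS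
        obtain ⟨T, hT, rfl⟩ := hS
        rw [mem_filter] at hT
        have hpt : p ∉ t := fun h => (mem_erase.1 (hts h)).1 rfl
        rw [mem_image]
        refine ⟨insert p t, ?_, erase_insert hpt⟩
        rw [mem_filter]
        refine ⟨hmem _ ?_ T hT.1 ?_, mem_insert_self _ _⟩
        · rw [card_insert_of_notMem hpt]; omega
        · exact insert_subset hT.2 (hts.trans (erase_subset _ _)))
    exact this.trans card_image_le
  have hVle : (N - 2).choose l ≤ #(Sh.filter fun S => ¬ p ∈ S) := by
    rw [← hc2, ← card_powersetCard]
    apply card_le_card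
    intro t ht
    rw [mem_powersetCard] at ht
    rw [mem_filter]
    refine ⟨?_, fun h => hpV (ht.1 h)⟩
    obtain ⟨S, hS1, hS2, hS3⟩ := exists_subsuperset_card_eq (n := N - l) ht.1 (by omega) (by omega)
    exact hmem t ht.2 S (hsub2 (mem_powersetCard.2 ⟨hS2, hS3⟩)) hS1
  have hShsplit := card_filter_add_card_filter_not (s := Sh) (fun S => p ∈ S)
  obtain ⟨m, rfl⟩ : ∃ m, N = m + 2 := ⟨N - 2, by omega⟩
  obtain ⟨j, rfl⟩ : ∃ j, l = j + 2 := ⟨l - 2, by omega⟩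
  have e1 := Nat.choose_succ_succ' (m + 1) (j + 1)
  have e2 := Nat.choose_succ_succ' m (j + 1)
  have e3 := Nat.choose_succ_succ' m j
  simp only [Nat.add_sub_cancel, show m + 2 - 1 = m + 1 by omega, show j + 2 - 1 = j + 1 by omega,
    show m + 1 + 1 = m + 2 by omega, show j + 1 + 1 = j + 2 by omega] at *
  omega

theorem transfer (V : Finset ℕ) (N : ℕ) (hV : #V = N) :
    ∃ φ : Finset (Finset ℕ) → Finset (Finset (Fin N)), ∃ e : Fin N ↪ ℕ,
      (∀ A, ∀ S ∈ φ A, S.map e ∈ A) ∧ (∀ A a, A ⊆ powersetCard a V → #(φ A) = #A) := by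
  classical
  set e : Fin N ↪ ℕ := (V.orderEmbOfFin hV).toEmbedding with he
  refine ⟨fun A => univ.filter fun S => S.map e ∈ A, e, fun A S hS => (mem_filter.1 hS).2, ?_⟩
  intro A a hA
  have : (univ.filter fun S : Finset (Fin N) => S.map e ∈ A).image (fun S => S.map e) = A := by
    ext T
    simp only [mem_image, mem_filter, mem_univ, true_and]
    constructor
    · rintro ⟨S, hS, rfl⟩; exact hS
    · intro hT
      have hTV := (mem_powersetCard.1 (hA hT)).1
      have h2 : (univ.filter fun x => e x ∈ T).map e = T := by
        ext x
        simp only [mem_map, mem_filter, mem_univ, true_and]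
        constructor
        · rintro ⟨y, hy, rfl⟩; exact hy
        · intro hx
          have : x ∈ Set.range (V.orderEmbOfFin hV) := by
            rw [range_orderEmbOfFin]; exact hTV hx
          obtain ⟨y, hy⟩ := this
          exact ⟨y, by rw [he]; simpa [hy] using hx, hy⟩
      exact ⟨_, by rw [h2]; exact hT, h2⟩
  conv_rhs => rw [← this]
  rw [card_image_of_injective]
  exact map_injective e

theorem transfer2 (V : Finset ℕ) (N a b : ℕ) (hV : #V = N) (A B : Finset (Finset ℕ))
    (hA : A ⊆ powersetCard a V) (hB : B ⊆ powersetCard b V)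
    (hc : ∀ S ∈ A, ∀ T ∈ B, (S ∩ T).Nonempty) :
    ∃ A' B' : Finset (Finset (Fin N)), #A' = #A ∧ #B' = #B ∧ (∀ S ∈ A', #S = a) ∧
      (∀ S ∈ B', #S = b) ∧ (∀ S ∈ A', ∀ T ∈ B', (S ∩ T).Nonempty) := by
  obtain ⟨φ, e, h1, h2⟩ := transfer V N hV
  refine ⟨φ A, φ B, h2 A a hA, h2 B b hB, ?_, ?_, ?_⟩
  · intro S hS
    have := (mem_powersetCard.1 (hA (h1 A S hS))).2
    rwa [card_map] at this
  · intro S hS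
    have := (mem_powersetCard.1 (hB (h1 B S hS))).2
    rwa [card_map] at this
  · intro S hS T hT
    have := hc _ (h1 A S hS) _ (h1 B T hT)
    rw [← map_inter] at this
    simpa using this

theorem cr_i {N a b : ℕ} (V : Finset ℕ) (hV : #V = N) (M : ℕ) (hab : a + b ≤ N) (hM : M ≤ N)
    (hbM : N - b ≤ M) (A B : Finset (Finset ℕ))
    (hA : A ⊆ powersetCard a V) (hB : B ⊆ powersetCard b V)
    (hc : ∀ S ∈ A, ∀ T ∈ B, (S ∩ T).Nonempty)
    (hBM : M.choose (N - b) ≤ #B) : #A + M.choose a ≤ N.choose a := by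
  obtain ⟨A', B', h1, h2, h3, h4, h5⟩ := transfer2 V N a b hV A B hA hB hc
  rw [← h1]; rw [← h2] at hBM
  exact fin_i M hab hM hbM A' B' h3 h4 h5 hBM

theorem cr_ii {N a b : ℕ} (V : Finset ℕ) (hV : #V = N) (hab : a + b ≤ N) (hab' : a ≤ b)
    (A B : Finset (Finset ℕ))
    (hA : A ⊆ powersetCard a V) (hB : B ⊆ powersetCard b V)
    (hc : ∀ S ∈ A, ∀ T ∈ B, (S ∩ T).Nonempty)
    (hBM : #B ≤ (a + (N - b)).choose a) : #A + #B ≤ N.choose a := by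
  obtain ⟨A', B', h1, h2, h3, h4, h5⟩ := transfer2 V N a b hV A B hA hB hc
  rw [← h1, ← h2]; rw [← h2] at hBM
  exact fin_ii hab hab' A' B' h3 h4 h5 hBM

/-- Cross-intersecting `l`-uniform families that are both not too small. -/
theorem cr_iii {N l : ℕ} (V : Finset ℕ) (hV : #V = N) (hl2 : 2 ≤ l) (hN : 2 * l ≤ N)
    (A B : Finset (Finset ℕ))
    (hA : A ⊆ powersetCard l V) (hB : B ⊆ powersetCard l V)
    (hc : ∀ S ∈ A, ∀ T ∈ B, (S ∩ T).Nonempty)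
    (hA1 : (N - 2).choose (l - 2) ≤ #A) (hB1 : (N - 2).choose (l - 2) ≤ #B) :
    #A + #B ≤ 2 * (N - 1).choose (l - 1) := by
  by_cases hB2 : #B ≤ (N - 1).choose (l - 1)
  · obtain ⟨A', B', h1, h2, h3, h4, h5⟩ := transfer2 V N l l hV A B hA hB hc
    rw [← h1, ← h2]
    exact fin_iii hl2 hN A' B' h3 h4 h5 (h2 ▸ hB1) (h2 ▸ hB2)
  · have hs1 : (N - 1).choose (l - 1) = (N - 1).choose (N - l) := by
      rw [← Nat.choose_symm (by omega)]; congr 1; omega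
    have h := cr_i V hV (N - 1) (by omega) (by omega) (by omega) A B hA hB hc (by omega)
    have e : N.choose l = (N - 1).choose (l - 1) + (N - 1).choose l := by
      obtain ⟨m, rfl⟩ : ∃ m, N = m + 1 := ⟨N - 1, by omega⟩
      obtain ⟨j, rfl⟩ : ∃ j, l = j + 1 := ⟨l - 1, by omega⟩
      exact Nat.choose_succ_succ' _ _
    have hA2 : #A ≤ (N - 1).choose (l - 1) := by omega
    obtain ⟨A', B', h1, h2, h3, h4, h5⟩ := transfer2 V N l l hV B A hB hA
      (fun S hS T hT => by rw [inter_comm]; exact hc T hT S hS)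
    rw [← h1, ← h2, add_comm]
    exact fin_iii hl2 hN A' B' h3 h4 h5 (h2 ▸ hA1) (h2 ▸ hA2)

/-- The ground set without `i` and `j`. -/
def grd (n i j : ℕ) : Finset ℕ := (Icc 1 n) \ {i, j}

/-- The trace link: sets `S` avoiding `i, j` with `S ∪ X ∈ F`. -/
def lk (n i j : ℕ) (F : Finset (Finset ℕ)) (X : Finset ℕ) : Finset (Finset ℕ) :=
  (grd n i j).powerset.filter fun S => S ∪ X ∈ F

theorem mem_lk {n i j : ℕ} {F : Finset (Finset ℕ)} {X S : Finset ℕ} :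
    S ∈ lk n i j F X ↔ S ⊆ grd n i j ∧ S ∪ X ∈ F := by
  simp [lk]

theorem mem_grd {n i j x : ℕ} : x ∈ grd n i j ↔ (1 ≤ x ∧ x ≤ n) ∧ x ≠ i ∧ x ≠ j := by
  simp [grd]

theorem card_grd {n i j : ℕ} (hi : i ∈ Icc 1 n) (hj : j ∈ Icc 1 n) (hij : i ≠ j) :
    #(grd n i j) = n - 2 := by
  rw [grd, card_sdiff_of_subset, Nat.card_Icc, card_pair hij]
  · omega
  · intro x hx
    simp only [mem_insert, mem_singleton] at hx
    rcases hx with rfl | rfl <;> assumption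

theorem lk_sized {n k i j : ℕ} {F : Finset (Finset ℕ)} (hF : F ⊆ powersetCard k (Icc 1 n))
    {X : Finset ℕ} (hX : X ⊆ {i, j}) : lk n i j F X ⊆ powersetCard (k - #X) (grd n i j) := by
  intro S hS
  rw [mem_lk] at hS
  rw [mem_powersetCard]
  refine ⟨hS.1, ?_⟩
  have h := (mem_powersetCard.1 (hF hS.2)).2
  rw [card_union_of_disjoint] at h
  · omega
  · rw [disjoint_left]
    intro x hx hx'
    have h1 := mem_grd.1 (hS.1 hx)
    have h2 := hX hx'
    simp only [mem_insert, mem_singleton] at h2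
    rcases h2 with h2 | h2
    · exact h1.2.1 h2
    · exact h1.2.2 h2

theorem lk_cross {n i j : ℕ} {F : Finset (Finset ℕ)}
    (hint : ∀ A ∈ F, ∀ B ∈ F, (A ∩ B).Nonempty)
    {X Y : Finset ℕ} (hX : X ⊆ {i, j}) (hY : Y ⊆ {i, j}) (hXY : Disjoint X Y) :
    ∀ S ∈ lk n i j F X, ∀ T ∈ lk n i j F Y, (S ∩ T).Nonempty := by
  intro S hS T hT
  rw [mem_lk] at hS hT
  obtain ⟨x, hx⟩ := hint _ hS.2 _ hT.2
  have hd := disjoint_left.1 hXY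
  have key : ∀ z, ∀ U ⊆ grd n i j, ∀ Z ⊆ ({i, j} : Finset ℕ), z ∈ U → z ∉ Z := by
    intro z U hU Z hZ hz hz'
    have h1 := mem_grd.1 (hU hz)
    have h2 := hZ hz'
    simp only [mem_insert, mem_singleton] at h2
    rcases h2 with h2 | h2
    · exact h1.2.1 h2
    · exact h1.2.2 h2
  have k1 := key x S hS.1 Y hY
  have k2 := key x T hT.1 X hX
  rw [mem_inter, mem_union, mem_union] at hx
  refine ⟨x, mem_inter.2 ?_⟩
  rcases hx with ⟨h1 | h1, h2 | h2⟩
  · exact ⟨h1, h2⟩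
  · exact absurd h2 (k1 h1)
  · exact absurd h1 (k2 h2)
  · exact absurd h2 (hd h1)

theorem card_lk {n k i j : ℕ} {F : Finset (Finset ℕ)} (hF : F ⊆ powersetCard k (Icc 1 n))
    {X : Finset ℕ} (hX : X ⊆ {i, j}) :
    #(lk n i j F X) = #(F.filter fun A => A ∩ {i, j} = X) := by
  have key : ∀ S, S ⊆ grd n i j → Disjoint S {i, j} := by
    intro S hS
    rw [disjoint_left]
    intro z hz hz'
    have h1 := mem_grd.1 (hS hz)
    simp only [mem_insert, mem_singleton] at hz'
    rcases hz' with h2 | h2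
    · exact h1.2.1 h2
    · exact h1.2.2 h2
  apply card_bij (fun S _ => S ∪ X)
  · intro S hS
    rw [mem_lk] at hS
    rw [mem_filter]
    refine ⟨hS.2, ?_⟩
    rw [union_inter_distrib_right, disjoint_iff_inter_eq_empty.1 (key S hS.1), empty_union,
      inter_eq_left.2 hX]
  · intro S hS T hT h
    rw [mem_lk] at hS hT
    have h1 := union_sdiff_cancel_right ((key S hS.1).mono_right hX)
    have h2 := union_sdiff_cancel_right ((key T hT.1).mono_right hX)
    rw [← h1, h, h2]
  · intro A hA
    rw [mem_filter] at hA
    refine ⟨A \ {i, j}, ?_, ?_⟩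
    · rw [mem_lk]
      refine ⟨sdiff_subset_sdiff (mem_powersetCard.1 (hF hA.1)).1 le_rfl, ?_⟩
      rw [← hA.2, sdiff_union_inter]; exact hA.1
    · rw [← hA.2, sdiff_union_inter]

theorem card_lk' {n k i j : ℕ} {F : Finset (Finset ℕ)} (hF : F ⊆ powersetCard k (Icc 1 n))
    (hij : i ≠ j) :
    #(lk n i j F {i, j}) = #(F.filter fun A => i ∈ A ∧ j ∈ A) ∧
    #(lk n i j F {i}) = #(F.filter fun A => i ∈ A ∧ j ∉ A) ∧
    #(lk n i j F {j}) = #(F.filter fun A => i ∉ A ∧ j ∈ A) ∧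
    #(lk n i j F ∅) = #(F.filter fun A => i ∉ A ∧ j ∉ A) := by
  refine ⟨?_, ?_, ?_, ?_⟩
  all_goals
    rw [card_lk hF (by simp)]
    congr 1
    apply filter_congr
    intro A _
    rw [Finset.ext_iff]
    simp only [mem_inter, mem_insert, mem_singleton, notMem_empty]
    grind

theorem card_split {n k i j : ℕ} {F : Finset (Finset ℕ)} (hF : F ⊆ powersetCard k (Icc 1 n))
    (hij : i ≠ j) :
    #F = #(lk n i j F {i, j}) + #(lk n i j F {i}) + #(lk n i j F {j}) + #(lk n i j F ∅) ∧
    #(F.filter fun A => i ∈ A) = #(lk n i j F {i, j}) + #(lk n i j F {i}) ∧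
    #(F.filter fun A => j ∈ A) = #(lk n i j F {i, j}) + #(lk n i j F {j}) ∧
    #(F.filter fun A => i ∉ A) = #(lk n i j F {j}) + #(lk n i j F ∅) ∧
    #(F.filter fun A => j ∉ A) = #(lk n i j F {i}) + #(lk n i j F ∅) := by
  obtain ⟨h1, h2, h3, h4⟩ := card_lk' (n := n) (k := k) hF hij
  have a1 := card_filter_add_card_filter_not (s := F) (fun A => i ∈ A)
  have a2 := card_filter_add_card_filter_not (s := F) (fun A => j ∈ A)
  have b1 := card_filter_add_card_filter_not (s := F.filter fun A => i ∈ A) (fun A => j ∈ A)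
  have b2 := card_filter_add_card_filter_not (s := F.filter fun A => i ∉ A) (fun A => j ∈ A)
  have c1 := card_filter_add_card_filter_not (s := F.filter fun A => j ∈ A) (fun A => i ∈ A)
  have c2 := card_filter_add_card_filter_not (s := F.filter fun A => j ∉ A) (fun A => i ∈ A)
  simp only [filter_filter] at b1 b2 c1 c2
  simp only [and_comm (a := j ∈ _), and_comm (a := j ∉ _)] at c1 c2
  omega

/-- Data of an intersecting family at a pair. -/
theorem D_small {n k : ℕ} (hk : 3 ≤ k) (hn : 2 * k < n) {V : Finset ℕ} (hV : #V = n - 2)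
    {E D : Finset (Finset ℕ)} (hE : E ⊆ powersetCard (k - 2) V) (hD : D ⊆ powersetCard k V)
    (hc : ∀ S ∈ E, ∀ T ∈ D, (S ∩ T).Nonempty) (h : #D ≤ (n - 4).choose (k - 2)) :
    #E + #D ≤ (n - 2).choose (k - 2) := by
  apply cr_ii V hV (by omega) (by omega) E D hE hD hc
  rwa [show k - 2 + (n - 2 - k) = n - 4 by omega]

theorem D_big {n k a : ℕ} (hk : 3 ≤ k) (hn : 2 * k < n) {V : Finset ℕ} (hV : #V = n - 2)
    {E D : Finset (Finset ℕ)} (ha : a + 1 ≤ k) (hE : E ⊆ powersetCard a V)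
    (hD : D ⊆ powersetCard k V)
    (hc : ∀ S ∈ E, ∀ T ∈ D, (S ∩ T).Nonempty) (h : (n - 4).choose (k - 2) ≤ #D) :
    #E + (n - 4).choose a ≤ (n - 2).choose a := by
  apply cr_i V hV (n - 4) (by omega) (by omega) (by omega) E D hE hD hc
  rw [← Nat.choose_symm (by omega)] at h
  rwa [show n - 4 - (k - 2) = n - 2 - k by omega] at h

theorem lk_facts {n k i j : ℕ} {F : Finset (Finset ℕ)} (hF : F ⊆ powersetCard k (Icc 1 n))
    (hij : i ≠ j) :
    lk n i j F {i, j} ⊆ powersetCard (k - 2) (grd n i j) ∧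
    lk n i j F {i} ⊆ powersetCard (k - 1) (grd n i j) ∧
    lk n i j F {j} ⊆ powersetCard (k - 1) (grd n i j) ∧
    lk n i j F ∅ ⊆ powersetCard k (grd n i j) := by
  refine ⟨?_, ?_, ?_, ?_⟩
  · have := lk_sized (i := i) (j := j) hF (X := {i, j}) (by simp)
    rwa [card_pair hij] at this
  · have := lk_sized (i := i) (j := j) hF (X := {i}) (by simp)
    rwa [card_singleton] at this
  · have := lk_sized (i := i) (j := j) hF (X := {j}) (by simp)
    rwa [card_singleton] at this
  · have := lk_sized (i := i) (j := j) hF (X := ∅) (by simp)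
    rwa [card_empty] at this

theorem pascals {n k : ℕ} (hk : 3 ≤ k) (hn : 2 * k < n) :
    (n - 3).choose (k - 2) = (n - 4).choose (k - 3) + (n - 4).choose (k - 2) ∧
    (n - 2).choose (k - 2) = (n - 3).choose (k - 3) + (n - 3).choose (k - 2) ∧
    (n - 2).choose (k - 1) = (n - 3).choose (k - 2) + (n - 3).choose (k - 1) ∧
    (n - 3).choose (k - 1) = (n - 4).choose (k - 2) + (n - 4).choose (k - 1) ∧
    (n - 4).choose (k - 3) ≤ (n - 4).choose (k - 2) := by
  obtain ⟨m, rfl⟩ : ∃ m, n = m + 4 := ⟨n - 4, by omega⟩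
  obtain ⟨j, rfl⟩ : ∃ j, k = j + 3 := ⟨k - 3, by omega⟩
  refine ⟨Nat.choose_succ_succ' _ _, Nat.choose_succ_succ' _ _, Nat.choose_succ_succ' _ _,
    Nat.choose_succ_succ' _ _, ?_⟩
  exact Nat.choose_le_succ_of_lt_half_left (by simp; omega)

theorem PQ_bound {n k : ℕ} (hk : 3 ≤ k) (hn : 2 * k < n) {V : Finset ℕ} (hV : #V = n - 2)
    {P Q : Finset (Finset ℕ)} (hP : P ⊆ powersetCard (k - 1) V) (hQ : Q ⊆ powersetCard (k - 1) V)
    (hc : ∀ S ∈ P, ∀ T ∈ Q, (S ∩ T).Nonempty)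
    (h1 : (n - 4).choose (k - 3) ≤ #P) (h2 : (n - 4).choose (k - 3) ≤ #Q) :
    #P + #Q ≤ 2 * (n - 3).choose (k - 2) :=
  cr_iii (N := n - 2) (l := k - 1) V hV (by omega) (by omega) P Q hP hQ hc h1 h2

theorem pair_lemma {n k i j : ℕ} (hk : 3 ≤ k) (hn : 2 * k < n) (hi : i ∈ Icc 1 n)
    (hj : j ∈ Icc 1 n) (hij : i ≠ j) {F : Finset (Finset ℕ)} (hF : F ⊆ powersetCard k (Icc 1 n))
    (hint : ∀ A ∈ F, ∀ B ∈ F, (A ∩ B).Nonempty)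
    (gi : (n - 3).choose (k - 2) ≤ #(F.filter fun A => i ∉ A))
    (gj : (n - 3).choose (k - 2) ≤ #(F.filter fun A => j ∉ A))
    (hD : #(lk n i j F ∅) ≤ (n - 4).choose (k - 2)) :
    #F ≤ (n - 2).choose (k - 2) + 2 * (n - 3).choose (k - 2) := by
  obtain ⟨s1, s2, s3, s4, s5⟩ := card_split hF hij
  obtain ⟨f1, f2, f3, f4⟩ := lk_facts hF hij
  have hV := card_grd hi hj hij
  have p := pascals hk hn
  have a1 := D_small hk hn hV f1 f4 (lk_cross hint (by simp) (by simp) (by simp)) hD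
  have a2 := PQ_bound hk hn hV f2 f3 (lk_cross hint (by simp) (by simp) (by simp [hij]))
    (by omega) (by omega)
  omega

theorem degree_lemma {n k i j : ℕ} (hk : 3 ≤ k) (hn : 2 * k < n) (hi : i ∈ Icc 1 n)
    (hj : j ∈ Icc 1 n) (hij : i ≠ j) {F : Finset (Finset ℕ)} (hF : F ⊆ powersetCard k (Icc 1 n))
    (hint : ∀ A ∈ F, ∀ B ∈ F, (A ∩ B).Nonempty)
    (gi : #(F.filter fun A => i ∉ A) < (n - 3).choose (k - 2))
    (hQD : #(F.filter fun A => i ∉ A ∧ j ∈ A) ≤ #(F.filter fun A => i ∉ A ∧ j ∉ A)) :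
    degree F j ≤ (n - 2).choose (k - 2) := by
  obtain ⟨s1, s2, s3, s4, s5⟩ := card_split hF hij
  obtain ⟨f1, f2, f3, f4⟩ := lk_facts hF hij
  obtain ⟨c1, c2, c3, c4⟩ := card_lk' (n := n) (k := k) hF hij
  have hV := card_grd hi hj hij
  have p := pascals hk hn
  unfold degree
  rw [← c3, ← c4] at hQD
  rcases le_total #(lk n i j F ∅) ((n - 4).choose (k - 2)) with h | h
  · have a1 := D_small hk hn hV f1 f4 (lk_cross hint (by simp) (by simp) (by simp)) h
    omega
  · have a1 := D_big hk hn hV (by omega) f1 f4 (lk_cross hint (by simp) (by simp) (by simp)) h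
    omega

theorem shift_deg {n k i j : ℕ} (hk : 3 ≤ k) (hn : 2 * k < n) (hi : i ∈ Icc 1 n)
    (hj : j ∈ Icc 1 n) (hij : i ≠ j) {F : Finset (Finset ℕ)} (hF : F ⊆ powersetCard k (Icc 1 n))
    (hint : ∀ A ∈ F, ∀ B ∈ F, (A ∩ B).Nonempty)
    (hD : (n - 4).choose (k - 2) ≤ #(lk n i j F ∅)) :
    #(lk n i j F {i, j}) + #(lk n i j F {i} ∪ lk n i j F {j}) ≤
      (n - 2).choose (k - 2) + (n - 3).choose (k - 2) := by
  obtain ⟨f1, f2, f3, f4⟩ := lk_facts hF hij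
  have hV := card_grd hi hj hij
  have p := pascals hk hn
  have a1 := D_big hk hn hV (by omega) f1 f4 (lk_cross hint (by simp) (by simp) (by simp)) hD
  have a2 := D_big hk hn hV (by omega) (union_subset f2 f3) f4 (by
    intro S hS T hT
    rcases mem_union.1 hS with h | h
    · exact lk_cross hint (by simp) (by simp) (by simp) S h T hT
    · exact lk_cross hint (by simp) (by simp) (by simp) S h T hT) hD
  omega

/-- The `(i,j)`-shift of a single set relative to a family. -/
def shf (i j : ℕ) (F : Finset (Finset ℕ)) (A : Finset ℕ) : Finset ℕ :=
  if i ∉ A ∧ j ∈ A ∧ insert i (A.erase j) ∉ F then insert i (A.erase j) else A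

theorem shf_injOn (i j : ℕ) (F : Finset (Finset ℕ)) : Set.InjOn (shf i j F) F := by
  intro A hA B hB h
  rw [mem_coe] at hA hB
  unfold shf at h
  split_ifs at h with h1 h2 h2
  · have e1 : A = insert j ((insert i (A.erase j)).erase i) := by
      rw [erase_insert (by simp [h1.1]), insert_erase h1.2.1]
    have e2 : B = insert j ((insert i (B.erase j)).erase i) := by
      rw [erase_insert (by simp [h2.1]), insert_erase h2.2.1]
    rw [e1, e2, h]
  · exact absurd (h ▸ hB) h1.2.2
  · exact absurd (h ▸ hA) h2.2.2
  · exact h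

/-- The shifted family. -/
def shF (i j : ℕ) (F : Finset (Finset ℕ)) : Finset (Finset ℕ) := F.image (shf i j F)

theorem card_shF (i j : ℕ) (F : Finset (Finset ℕ)) : #(shF i j F) = #F :=
  card_image_of_injOn (shf_injOn i j F)

theorem shF_sized {n k i j : ℕ} (hi : i ∈ Icc 1 n) {F : Finset (Finset ℕ)}
    (hF : F ⊆ powersetCard k (Icc 1 n)) : shF i j F ⊆ powersetCard k (Icc 1 n) := by
  intro A hA
  rw [shF, mem_image] at hA
  obtain ⟨B, hB, rfl⟩ := hA
  have hB' := mem_powersetCard.1 (hF hB)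
  unfold shf
  split_ifs with h
  · rw [mem_powersetCard]
    refine ⟨insert_subset hi ((erase_subset _ _).trans hB'.1), ?_⟩
    rw [card_insert_of_notMem (by simp [h.1]), card_erase_of_mem h.2.1, hB'.2]
    have : 0 < #B := card_pos.2 ⟨j, h.2.1⟩
    omega
  · exact hF hB

theorem shF_int {i j : ℕ} {F : Finset (Finset ℕ)}
    (hint : ∀ A ∈ F, ∀ B ∈ F, (A ∩ B).Nonempty) :
    ∀ A ∈ shF i j F, ∀ B ∈ shF i j F, (A ∩ B).Nonempty := by
  have key : ∀ A ∈ F, ∀ B ∈ F, ¬ (i ∉ A ∧ j ∈ A ∧ insert i (A.erase j) ∉ F) →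
      (i ∉ B ∧ j ∈ B ∧ insert i (B.erase j) ∉ F) → (A ∩ insert i (B.erase j)).Nonempty := by
    intro A hA B hB h1 h2
    by_cases hiA : i ∈ A
    · exact ⟨i, by simp [hiA]⟩
    by_cases hjA : j ∈ A
    · have h3 : insert i (A.erase j) ∈ F := by
        by_contra h; exact h1 ⟨hiA, hjA, h⟩
      obtain ⟨x, hx⟩ := hint _ h3 _ hB
      refine ⟨x, ?_⟩
      simp only [mem_inter, mem_insert, mem_erase] at hx ⊢
      rcases hx with ⟨rfl | hx, hxB⟩
      · exact absurd hxB h2.1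
      · exact ⟨hx.2, Or.inr ⟨hx.1, hxB⟩⟩
    · obtain ⟨x, hx⟩ := hint _ hA _ hB
      refine ⟨x, ?_⟩
      simp only [mem_inter, mem_insert, mem_erase] at hx ⊢
      exact ⟨hx.1, Or.inr ⟨fun h => hjA (h ▸ hx.1), hx.2⟩⟩
  intro A hA B hB
  rw [shF, mem_image] at hA hB
  obtain ⟨A, hA, rfl⟩ := hA
  obtain ⟨B, hB, rfl⟩ := hB
  unfold shf
  split_ifs with h1 h2 h2
  · exact ⟨i, by simp⟩
  · rw [inter_comm]; exact key B hB A hA h2 h1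
  · exact key A hA B hB h1 h2
  · exact hint A hA B hB

theorem shF_gamma {i j x : ℕ} (hx : x ≠ i) (F : Finset (Finset ℕ)) :
    #(F.filter fun A => x ∉ A) ≤ #((shF i j F).filter fun A => x ∉ A) := by
  apply card_le_card_of_injOn (shf i j F)
  · intro A hA
    rw [mem_coe, mem_filter] at hA
    rw [mem_coe, mem_filter]
    refine ⟨mem_image_of_mem _ hA.1, ?_⟩
    unfold shf
    split_ifs
    · simp [hx, hA.2]
    · exact hA.2
  · exact (shf_injOn i j F).mono (by intro A hA; rw [mem_coe, mem_filter] at hA; exact hA.1)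

theorem shF_deg {n k i j : ℕ} (hij : i ≠ j) {F : Finset (Finset ℕ)}
    (hF : F ⊆ powersetCard k (Icc 1 n)) :
    #((shF i j F).filter fun A => i ∈ A) ≤
      #(lk n i j F {i, j}) + #(lk n i j F {i} ∪ lk n i j F {j}) := by
  rw [← card_filter_add_card_filter_not (s := (shF i j F).filter fun A => i ∈ A) (fun A => j ∈ A)]
  have hmem : ∀ A ∈ shF i j F, A ∈ F ∨ ∃ B ∈ F, i ∉ B ∧ j ∈ B ∧ A = insert i (B.erase j) := by
    intro A hA
    rw [shF, mem_image] at hA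
    obtain ⟨B, hB, rfl⟩ := hA
    unfold shf
    split_ifs with h
    · exact Or.inr ⟨B, hB, h.1, h.2.1, rfl⟩
    · exact Or.inl hB
  have hsub : ∀ B ∈ F, B ⊆ Icc 1 n := fun B hB => (mem_powersetCard.1 (hF hB)).1
  apply Nat.add_le_add
  · apply card_le_card_of_injOn (fun A => A \ {i, j})
    · intro A hA
      simp only [coe_filter, mem_filter, Set.mem_ofPred_eq] at hA
      rw [mem_coe, mem_lk]
      have hAF : A ∈ F := by
        rcases hmem A hA.1.1 with h | ⟨B, hB, h1, h2, rfl⟩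
        · exact h
        · exfalso
          have := hA.2
          simp at this
          exact hij this.symm
      refine ⟨sdiff_subset_sdiff (hsub A hAF) le_rfl, ?_⟩
      rw [sdiff_union_of_subset]
      · exact hAF
      · intro x hx; simp only [mem_insert, mem_singleton] at hx
        rcases hx with rfl | rfl
        exacts [hA.1.2, hA.2]
    · intro A hA B hB h
      simp only [coe_filter, mem_filter, Set.mem_ofPred_eq] at hA hB h
      have e : ∀ A : Finset ℕ, i ∈ A → j ∈ A → A \ {i, j} ∪ {i, j} = A := by
        intro A h1 h2
        rw [sdiff_union_of_subset]
        intro x hx; simp only [mem_insert, mem_singleton] at hx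
        rcases hx with rfl | rfl <;> assumption
      rw [← e A hA.1.2 hA.2, h, e B hB.1.2 hB.2]
  · apply card_le_card_of_injOn (fun A => A.erase i)
    · intro A hA
      simp only [coe_filter, mem_filter, Set.mem_ofPred_eq] at hA
      simp only [mem_coe, mem_union, mem_lk]
      rcases hmem A hA.1.1 with h | ⟨B, hB, h1, h2, rfl⟩
      · left
        refine ⟨?_, ?_⟩
        · intro x hx
          rw [mem_erase] at hx
          have := mem_Icc.1 (hsub A h hx.2)
          rw [mem_grd]
          exact ⟨this, hx.1, fun h' => hA.2 (h' ▸ hx.2)⟩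
        · rw [union_comm, ← insert_eq, insert_erase hA.1.2]; exact h
      · right
        rw [erase_insert (by simp [h1])]
        refine ⟨?_, ?_⟩
        · intro x hx
          rw [mem_erase] at hx
          have := mem_Icc.1 (hsub B hB hx.2)
          rw [mem_grd]
          exact ⟨this, fun h' => h1 (h' ▸ hx.2), hx.1⟩
        · rw [union_comm, ← insert_eq, insert_erase h2]; exact hB
    · intro A hA B hB h
      simp only [coe_filter, mem_filter, Set.mem_ofPred_eq] at hA hB h
      rw [← insert_erase hA.1.2, h, insert_erase hB.1.2]

theorem shF_measure {i j : ℕ} (hij : i < j) {F : Finset (Finset ℕ)}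
    (h : ∃ A ∈ F, i ∉ A ∧ j ∈ A ∧ insert i (A.erase j) ∉ F) :
    ∑ A ∈ shF i j F, ∑ x ∈ A, x < ∑ A ∈ F, ∑ x ∈ A, x := by
  rw [shF, sum_image (shf_injOn i j F)]
  have key : ∀ A, i ∉ A → j ∈ A → ∑ x ∈ insert i (A.erase j), x < ∑ x ∈ A, x := by
    intro A h1 h2
    rw [sum_insert (by simp [h1]), ← add_sum_erase A (fun x => x) h2]
    omega
  apply sum_lt_sum
  · intro A hA
    unfold shf
    split_ifs with h1
    · exact (key A h1.1 h1.2.1).le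
    · exact le_rfl
  · obtain ⟨A, hA, h1⟩ := h
    refine ⟨A, hA, ?_⟩
    unfold shf
    rw [if_pos h1]
    exact key A h1.1 h1.2.1

/-- Families closed under all left shifts. -/
def Shifted (F : Finset (Finset ℕ)) : Prop :=
  ∀ i j, 1 ≤ i → i < j → ∀ A ∈ F, i ∉ A → j ∈ A → insert i (A.erase j) ∈ F

theorem dom_s17 {n k : ℕ} {F : Finset (Finset ℕ)} (hF : F ⊆ powersetCard k (Icc 1 n))
    (hs : Shifted F) (Z : Finset ℕ) (hZ : Z ⊆ Icc 1 n) (d : ℕ) : ∀ A ∈ F, #(A \ Z) = d →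
    (∀ m ≤ n, #(A.filter (· ≤ m)) ≤ #(Z.filter (· ≤ m))) → ∃ B ∈ F, B ⊆ Z := by
  induction d with
  | zero =>
    intro A hA h _
    exact ⟨A, hA, sdiff_eq_empty_iff_subset.1 (card_eq_zero.1 h)⟩
  | succ d ih =>
    intro A hA h hm
    have hne : (A \ Z).Nonempty := card_pos.1 (by omega)
    obtain ⟨j, hj, hjmin⟩ := exists_min_image (A \ Z) id hne
    rw [mem_sdiff] at hj
    have hAn := (mem_powersetCard.1 (hF hA)).1
    have hmin : ∀ x ∈ A, x < j → x ∈ Z := by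
      intro x hx hxj
      by_contra hxZ
      have := hjmin x (mem_sdiff.2 ⟨hx, hxZ⟩)
      simp at this; omega
    have hjn := mem_Icc.1 (hAn hj.1)
    obtain ⟨i, hiZ, hiA, hij⟩ : ∃ i ∈ Z, i ∉ A ∧ i < j := by
      by_contra! hcon
      have h1 : Z.filter (· ≤ j) ⊆ (A.filter (· ≤ j)).erase j := by
        intro x hx
        rw [mem_filter] at hx
        have hxj : x ≠ j := fun h => hj.2 (h ▸ hx.1)
        rw [mem_erase, mem_filter]
        refine ⟨hxj, ?_, hx.2⟩
        by_contra hxA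
        have := hcon x hx.1 hxA
        omega
      have h2 := card_le_card h1
      rw [card_erase_of_mem (by simp [hj.1])] at h2
      have h3 := hm j hjn.2
      have h4 : 0 < #(A.filter (· ≤ j)) := card_pos.2 ⟨j, by simp [hj.1]⟩
      omega
    apply ih (insert i (A.erase j)) (hs i j (mem_Icc.1 (hZ hiZ)).1 hij A hA hiA hj.1)
    · have : insert i (A.erase j) \ Z = (A \ Z).erase j := by
        ext x
        simp only [mem_sdiff, mem_insert, mem_erase]
        constructor
        · rintro ⟨rfl | h1, h2⟩
          · exact absurd hiZ h2
          · exact ⟨h1.1, h1.2, h2⟩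
        · rintro ⟨h1, h2, h3⟩
          exact ⟨Or.inr ⟨h1, h2⟩, h3⟩
      rw [this, card_erase_of_mem (mem_sdiff.2 hj), h]; rfl
    · intro m hmn
      by_cases h1 : m < j
      · by_cases h2 : m < i
        · refine le_trans (card_le_card ?_) (hm m hmn)
          intro x hx
          simp only [mem_filter, mem_insert, mem_erase] at hx ⊢
          rcases hx with ⟨rfl | hx, hxm⟩
          · omega
          · exact ⟨hx.2, hxm⟩
        · apply card_le_card
          intro x hx
          simp only [mem_filter, mem_insert, mem_erase] at hx ⊢
          rcases hx with ⟨rfl | hx, hxm⟩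
          · exact ⟨hiZ, hxm⟩
          · exact ⟨hmin x hx.2 (by omega), hxm⟩
      · refine le_trans ?_ (hm m hmn)
        have h3 : (insert i (A.erase j)).filter (· ≤ m) ⊆ insert i ((A.filter (· ≤ m)).erase j) := by
          intro x hx
          simp only [mem_filter, mem_insert, mem_erase] at hx ⊢
          tauto
        have h4 := card_le_card h3
        have h5 := card_insert_le i ((A.filter (· ≤ m)).erase j)
        have hjm : j ∈ A.filter (· ≤ m) := by rw [mem_filter]; exact ⟨hj.1, by omega⟩
        rw [card_erase_of_mem hjm] at h5
        have h6 := card_pos.2 ⟨j, hjm⟩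
        omega

/-- `X` is the reflection of `D` at the last time `t` where the walk of `D` is at height two. -/
def IsWalk (n : ℕ) (D : Finset ℕ) (t : ℕ) (X : Finset ℕ) : Prop :=
  X = (Icc 3 t \ D) ∪ D.filter (t < ·) ∧ 2 ≤ t ∧ t ≤ n ∧ 2 * #(D.filter (· ≤ t)) = t ∧
    ∀ m, t < m → m ≤ n → 2 * #(D.filter (· ≤ m)) < m

theorem walk_count {n : ℕ} {D X : Finset ℕ} {t : ℕ} (hD : D ⊆ Icc 3 n) (h : IsWalk n D t X) :
    #(X.filter (· ≤ t)) + 2 + #(D.filter (· ≤ t)) = t ∧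
    ∀ m, t ≤ m → #(X.filter (· ≤ m)) + #(D.filter (· ≤ t)) =
      #(X.filter (· ≤ t)) + #(D.filter (· ≤ m)) := by
  obtain ⟨rfl, h2, h3, h4, h5⟩ := h
  constructor
  · have e : (Icc 3 t \ D ∪ D.filter (t < ·)).filter (· ≤ t) = Icc 3 t \ D.filter (· ≤ t) := by
      ext x
      simp only [mem_filter, mem_union, mem_sdiff, mem_Icc]
      grind
    have hsub : D.filter (· ≤ t) ⊆ Icc 3 t := by
      intro x hx
      rw [mem_filter] at hx
      have := mem_Icc.1 (hD hx.1)
      rw [mem_Icc]; omega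
    have := card_le_card hsub
    rw [e, card_sdiff_of_subset hsub]
    rw [Nat.card_Icc] at *
    omega
  · intro m hm
    set X := Icc 3 t \ D ∪ D.filter (t < ·) with hX
    have a1 := card_filter_add_card_filter_not (s := X.filter (· ≤ m)) (· ≤ t)
    have a2 := card_filter_add_card_filter_not (s := D.filter (· ≤ m)) (· ≤ t)
    have e1 : (X.filter (· ≤ m)).filter (· ≤ t) = X.filter (· ≤ t) := by
      ext x; simp only [mem_filter]; grind
    have e2 : (D.filter (· ≤ m)).filter (· ≤ t) = D.filter (· ≤ t) := by
      ext x; simp only [mem_filter]; grind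
    have e3 : (X.filter (· ≤ m)).filter (fun x => ¬ x ≤ t) =
        (D.filter (· ≤ m)).filter (fun x => ¬ x ≤ t) := by
      ext x; simp only [hX, mem_filter, mem_union, mem_sdiff, mem_Icc]; grind
    rw [e1, e3] at a1
    rw [e2] at a2
    omega

theorem walk_inj {n : ℕ} {D1 D2 X : Finset ℕ} {t1 t2 : ℕ} (hD1 : D1 ⊆ Icc 3 n)
    (hD2 : D2 ⊆ Icc 3 n) (h1 : IsWalk n D1 t1 X) (h2 : IsWalk n D2 t2 X) : D1 = D2 := by
  have key : ∀ D1 D2 t1 t2, D1 ⊆ Icc 3 n → D2 ⊆ Icc 3 n → IsWalk n D1 t1 X → IsWalk n D2 t2 X →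
      t2 ≤ t1 := by
    intro D1 D2 t1 t2 hD1 hD2 h1 h2
    by_contra hlt
    obtain ⟨a1, a2⟩ := walk_count hD1 h1
    obtain ⟨b1, b2⟩ := walk_count hD2 h2
    have a3 := a2 t2 (by omega)
    have a4 := h1.2.2.2.2 t2 (by omega) h2.2.2.1
    have a5 := h1.2.2.2.1
    have b5 := h2.2.2.2.1
    omega
  have ht : t1 = t2 := le_antisymm (key D2 D1 t2 t1 hD2 hD1 h2 h1) (key D1 D2 t1 t2 hD1 hD2 h1 h2)
  subst ht
  have e := h1.1.symm.trans h2.1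
  rw [Finset.ext_iff] at e
  ext x
  have ex := e x
  simp only [mem_union, mem_sdiff, mem_Icc, mem_filter] at ex
  have k1 : x ∈ D1 → 3 ≤ x := fun h => (mem_Icc.1 (hD1 h)).1
  have k2 : x ∈ D2 → 3 ≤ x := fun h => (mem_Icc.1 (hD2 h)).1
  grind

theorem walk_exists {n k : ℕ} (hk : 3 ≤ k) (hn : 2 * k < n) {F : Finset (Finset ℕ)}
    (hF : F ⊆ powersetCard k (Icc 1 n)) (hint : ∀ A ∈ F, ∀ B ∈ F, (A ∩ B).Nonempty)
    (hs : Shifted F) (D : Finset ℕ) (hD : D ∈ F) (hD3 : D ⊆ Icc 3 n) :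
    ∃ t X, IsWalk n D t X ∧ X ⊆ Icc 3 n ∧ #X = k - 2 ∧ X ∪ {1, 2} ∉ F := by
  have hDk := (mem_powersetCard.1 (hF hD)).2
  have hDn : D.filter (· ≤ n) = D := by
    apply filter_true_of_mem
    intro x hx; exact (mem_Icc.1 (hD3 hx)).2
  -- the walk goes above height two
  obtain ⟨m0, hm0n, hm0⟩ : ∃ m ≤ n, m < 2 * #(D.filter (· ≤ m)) := by
    by_contra! hcon
    obtain ⟨B, hB, hBZ⟩ := dom_s17 hF hs (Icc 1 n \ D) sdiff_subset _ D hD rfl (by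
      intro m hm
      have e : (Icc 1 n \ D).filter (· ≤ m) = Icc 1 m \ D.filter (· ≤ m) := by
        ext x; simp only [mem_filter, mem_sdiff, mem_Icc]; grind
      have hsub : D.filter (· ≤ m) ⊆ Icc 1 m := by
        intro x hx
        rw [mem_filter] at hx
        have := mem_Icc.1 (hD3 hx.1)
        rw [mem_Icc]; omega
      rw [e, card_sdiff_of_subset hsub, Nat.card_Icc]
      have := hcon m hm
      omega)
    obtain ⟨x, hx⟩ := hint _ hD _ hB
    rw [mem_inter] at hx
    exact (mem_sdiff.1 (hBZ hx.2)).2 hx.1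
  set t := Nat.findGreatest (fun m => m ≤ 2 * #(D.filter (· ≤ m))) n with ht
  have htn : t ≤ n := Nat.findGreatest_le n
  have hm0t : m0 ≤ t := Nat.le_findGreatest hm0n hm0.le
  have hm03 : 3 ≤ m0 := by
    have : 0 < #(D.filter (· ≤ m0)) := by omega
    obtain ⟨x, hx⟩ := card_pos.1 this
    rw [mem_filter] at hx
    have := mem_Icc.1 (hD3 hx.1)
    omega
  have hle : t ≤ 2 * #(D.filter (· ≤ t)) :=
    Nat.findGreatest_spec (P := fun m => m ≤ 2 * #(D.filter (· ≤ m))) hm0n hm0.le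
  have hgt : ∀ m, t < m → m ≤ n → 2 * #(D.filter (· ≤ m)) < m := by
    intro m h1 h2
    have := Nat.findGreatest_is_greatest h1 h2
    simpa using this
  have htn' : t < n := by
    rcases htn.lt_or_eq with h | h
    · exact h
    · rw [h, hDn, hDk] at hle; omega
  have heq : 2 * #(D.filter (· ≤ t)) = t := by
    have h1 := hgt (t + 1) (by omega) (by omega)
    have h2 : #(D.filter (· ≤ t)) ≤ #(D.filter (· ≤ t + 1)) := by
      apply card_le_card
      intro x hx
      rw [mem_filter] at hx ⊢
      exact ⟨hx.1, by omega⟩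
    omega
  set X := (Icc 3 t \ D) ∪ D.filter (t < ·) with hX
  have hw : IsWalk n D t X := ⟨rfl, by omega, htn, heq, hgt⟩
  have hX3 : X ⊆ Icc 3 n := by
    intro x hx
    rw [hX, mem_union, mem_sdiff, mem_filter, mem_Icc] at hx
    rcases hx with hx | hx
    · rw [mem_Icc]; omega
    · exact hD3 hx.1
  have hXn : X.filter (· ≤ n) = X := by
    apply filter_true_of_mem
    intro x hx; exact (mem_Icc.1 (hX3 hx)).2
  obtain ⟨w1, w2⟩ := walk_count hD3 hw
  have w3 := w2 n htn
  rw [hXn, hDn, hDk] at w3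
  refine ⟨t, X, hw, hX3, by omega, ?_⟩
  intro hcon
  obtain ⟨B, hB, hBZ⟩ := dom_s17 hF hs (Icc 3 n \ X) (sdiff_subset.trans (Icc_subset_Icc_left (by omega)))
    _ D hD rfl (by
    intro m hm
    by_cases hmt : m ≤ t
    · apply card_le_card
      intro x hx
      rw [mem_filter] at hx
      have hx3 := hD3 hx.1
      simp only [hX, mem_filter, mem_sdiff, mem_union, not_or, not_and, not_not]
      exact ⟨⟨hx3, fun _ => hx.1, fun _ => by omega⟩, hx.2⟩
    · have e : (Icc 3 n \ X).filter (· ≤ m) = Icc 3 m \ X.filter (· ≤ m) := by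
        ext x; simp only [mem_filter, mem_sdiff, mem_Icc]; grind
      have hsub : X.filter (· ≤ m) ⊆ Icc 3 m := by
        intro x hx
        rw [mem_filter] at hx
        have := mem_Icc.1 (hX3 hx.1)
        rw [mem_Icc]; omega
      rw [e, card_sdiff_of_subset hsub, Nat.card_Icc]
      have h1 := hgt m (by omega) hm
      have h2 := w2 m (by omega)
      omega)
  obtain ⟨x, hx⟩ := hint _ hB _ hcon
  rw [mem_inter, mem_union] at hx
  have hx1 := mem_sdiff.1 (hBZ hx.1)
  rcases hx.2 with h | h
  · exact hx1.2 h
  · have := mem_Icc.1 hx1.1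
    simp only [mem_insert, mem_singleton] at h
    omega

theorem ED_bound {n k : ℕ} (hk : 3 ≤ k) (hn : 2 * k < n) {F : Finset (Finset ℕ)}
    (hF : F ⊆ powersetCard k (Icc 1 n)) (hint : ∀ A ∈ F, ∀ B ∈ F, (A ∩ B).Nonempty)
    (hs : Shifted F) :
    #(lk n 1 2 F {1, 2}) + #(lk n 1 2 F ∅) ≤ (n - 2).choose (k - 2) := by
  have hg : grd n 1 2 = Icc 3 n := by
    ext x; rw [mem_grd, mem_Icc]; omega
  have h1 : ∀ D ∈ lk n 1 2 F ∅, ∃ X, (∃ t, IsWalk n D t X) ∧ X ⊆ Icc 3 n ∧ #X = k - 2 ∧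
      X ∪ {1, 2} ∉ F := by
    intro D hD
    rw [mem_lk, hg, union_empty] at hD
    obtain ⟨t, X, h1, h2⟩ := walk_exists hk hn hF hint hs D hD.2 hD.1
    exact ⟨X, ⟨t, h1⟩, h2⟩
  choose! f hf using h1
  have hE := (lk_facts hF (show (1 : ℕ) ≠ 2 by omega)).1
  have h2 : #(lk n 1 2 F ∅) ≤ #(powersetCard (k - 2) (grd n 1 2) \ lk n 1 2 F {1, 2}) := by
    apply card_le_card_of_injOn f
    · intro D hD
      have := hf D hD
      rw [mem_coe, mem_sdiff, mem_powersetCard, mem_lk, hg]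
      exact ⟨⟨this.2.1, this.2.2.1⟩, fun h => this.2.2.2 h.2⟩
    · intro D hD D' hD' h
      obtain ⟨⟨t, ht⟩, -⟩ := hf D hD
      obtain ⟨⟨t', ht'⟩, -⟩ := hf D' hD'
      rw [mem_coe, mem_lk, hg] at hD hD'
      rw [h] at ht
      exact walk_inj hD.1 hD'.1 ht ht'
  rw [card_sdiff_of_subset hE, card_powersetCard,
    card_grd (by rw [mem_Icc]; omega) (by rw [mem_Icc]; omega) (by omega)] at h2
  have h3 := card_le_card hE
  rw [card_powersetCard,
    card_grd (by rw [mem_Icc]; omega) (by rw [mem_Icc]; omega) (by omega)] at h3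
  omega

theorem shifted_bound {n k : ℕ} (hk : 3 ≤ k) (hn : 2 * k < n) {F : Finset (Finset ℕ)}
    (hF : F ⊆ powersetCard k (Icc 1 n)) (hint : ∀ A ∈ F, ∀ B ∈ F, (A ∩ B).Nonempty)
    (hs : Shifted F)
    (g : ∀ x ∈ Icc 1 n, (n - 3).choose (k - 2) ≤ #(F.filter fun A => x ∉ A)) :
    #F ≤ (n - 2).choose (k - 2) + 2 * (n - 3).choose (k - 2) := by
  have m1 : 1 ∈ Icc 1 n := by rw [mem_Icc]; omega
  have m2 : 2 ∈ Icc 1 n := by rw [mem_Icc]; omega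
  have hne : (1 : ℕ) ≠ 2 := by omega
  rcases le_total #(lk n 1 2 F ∅) ((n - 4).choose (k - 2)) with h | h
  · exact pair_lemma hk hn m1 m2 hne hF hint (g 1 m1) (g 2 m2) h
  · obtain ⟨s1, -⟩ := card_split hF hne
    obtain ⟨f1, f2, f3, f4⟩ := lk_facts hF hne
    have hV := card_grd m1 m2 hne
    have hED := ED_bound hk hn hF hint hs
    -- the second link dominates the shadow of the last one
    have hQ := nm_count_gen (k - 1) k (grd n 1 2) (lk n 1 2 F ∅) (lk n 1 2 F {2}) f4 (by
      intro S hS t hts htk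
      have hSk := (mem_powersetCard.1 (f4 hS)).2
      rw [mem_lk, union_empty] at hS
      rw [mem_lk]
      refine ⟨hts.trans hS.1, ?_⟩
      obtain ⟨x, hx⟩ : ∃ x, S \ t = {x} := by
        rw [← card_eq_one, card_sdiff_of_subset hts]; omega
      have hxS : x ∈ S \ t := by rw [hx]; exact mem_singleton_self x
      rw [mem_sdiff] at hxS
      have hxg := mem_grd.1 (hS.1 hxS.1)
      have e : t ∪ {2} = insert 2 (S.erase x) := by
        rw [union_comm, ← insert_eq]
        congr 1
        apply eq_of_subset_of_card_le
        · intro y hy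
          rw [mem_erase]
          exact ⟨fun h => hxS.2 (h ▸ hy), hts hy⟩
        · rw [card_erase_of_mem hxS.1]; omega
      rw [e]
      exact hs 2 x (by omega) (by omega) S hS.2 (fun h => (mem_grd.1 (hS.1 h)).2.2 rfl) hxS.1)
    have hQ' : (n - 4).choose (k - 3) ≤ #(lk n 1 2 F {2}) := by
      rw [hV, show k - (k - 1) = 1 by omega, Nat.choose_one_right,
        ← Nat.choose_symm (show k - 1 ≤ k by omega), show k - (k - 1) = 1 by omega,
        Nat.choose_one_right] at hQ
      have e := Nat.choose_succ_right_eq (n - 4) (k - 3)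
      rw [show k - 3 + 1 = k - 2 by omega, show n - 4 - (k - 3) = n - 2 - (k - 1) by omega] at e
      apply Nat.le_of_mul_le_mul_right _ (show 0 < n - 2 - (k - 1) by omega)
      rw [← e]
      exact le_trans (Nat.mul_le_mul h (by omega)) hQ
    have hPQ : #(lk n 1 2 F {2}) ≤ #(lk n 1 2 F {1}) := by
      apply card_le_card
      intro S hS
      rw [mem_lk] at hS ⊢
      refine ⟨hS.1, ?_⟩
      have k1 : 1 ∉ S := fun h => (mem_grd.1 (hS.1 h)).2.1 rfl
      have k2 : 2 ∉ S := fun h => (mem_grd.1 (hS.1 h)).2.2 rfl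
      have := hs 1 2 le_rfl (by omega) _ hS.2 (by simp [k1]) (by simp)
      rw [union_comm, ← insert_eq] at this ⊢
      rwa [erase_insert k2] at this
    have a2 := PQ_bound hk hn hV f2 f3 (lk_cross hint (by simp) (by simp) (by simp))
      (hQ'.trans hPQ) hQ'
    omega

theorem frankl_degree {n k : ℕ} (hk : 3 ≤ k) (hn : 2 * k < n) (w : ℕ) : ∀ F : Finset (Finset ℕ),
    ∑ A ∈ F, ∑ x ∈ A, x = w →
    F ⊆ powersetCard k (Icc 1 n) → (∀ A ∈ F, ∀ B ∈ F, (A ∩ B).Nonempty) →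
    (∀ x ∈ Icc 1 n, (n - 3).choose (k - 2) ≤ #(F.filter fun A => x ∉ A)) →
    #F ≤ (n - 2).choose (k - 2) + 2 * (n - 3).choose (k - 2) := by
  induction w using Nat.strong_induction_on with
  | _ w ih =>
    intro F hw hF hint g
    by_cases hs : Shifted F
    · exact shifted_bound hk hn hF hint hs g
    unfold Shifted at hs
    push Not at hs
    obtain ⟨i, j, hi, hij, A, hA, hiA, hjA, hAF⟩ := hs
    have hjn := mem_Icc.1 ((mem_powersetCard.1 (hF hA)).1 hjA)
    have mi : i ∈ Icc 1 n := by rw [mem_Icc]; omega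
    have mj : j ∈ Icc 1 n := by rw [mem_Icc]; omega
    have hsF := shF_sized (j := j) mi hF
    have hsint := shF_int (i := i) (j := j) hint
    rw [← card_shF i j F]
    by_cases hg : (n - 3).choose (k - 2) ≤ #((shF i j F).filter fun A => i ∉ A)
    · refine ih _ ?_ (shF i j F) rfl hsF hsint ?_
      · rw [← hw]; exact shF_measure hij ⟨A, hA, hiA, hjA, hAF⟩
      · intro x hx
        by_cases hxi : x = i
        · rw [hxi]; exact hg
        · exact (g x hx).trans (shF_gamma hxi F)
    · rcases le_total #(lk n i j F ∅) ((n - 4).choose (k - 2)) with h | h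
      · rw [card_shF]
        exact pair_lemma hk hn mi mj hij.ne hF hint (g i mi) (g j mj) h
      · have h1 := shift_deg hk hn mi mj hij.ne hF hint h
        have h2 := shF_deg hij.ne hF
        have h3 := card_filter_add_card_filter_not (s := shF i j F) (fun A => i ∈ A)
        omega

/-- If at most `m` elements have degree above `C`, the next degree is at most `C`. -/
theorem nthDegree_le {n : ℕ} {F : Finset (Finset ℕ)} {m C : ℕ}
    (h : #((Icc 1 n).filter fun y => C < degree F y) ≤ m) : nthDegree n F (m + 1) ≤ C := by
  unfold nthDegree
  set L := ((Finset.Icc 1 n).val.map (degree F)).sort (· ≥ ·) with hL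
  have hp : L.Pairwise (· ≥ ·) := Multiset.pairwise_sort _ _
  have hc : (L : Multiset ℕ) = (Finset.Icc 1 n).val.map (degree F) := Multiset.sort_eq _ _
  have hcount : L.countP (fun d => C < d) ≤ m := by
    rw [← Multiset.coe_countP, hc, Multiset.countP_map]
    exact h
  by_contra hcon
  push Not at hcon
  rw [Nat.add_sub_cancel] at hcon
  have hlen : m < L.length := by
    by_contra hm
    rw [List.getD_eq_default _ _ (by omega)] at hcon
    omega
  rw [List.getD_eq_getElem _ _ hlen] at hcon
  have h1 : (L.take (m + 1)).countP (fun d => C < d) = (L.take (m + 1)).length := by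
    rw [List.countP_eq_length]
    intro a ha
    obtain ⟨i, hi, rfl⟩ := List.mem_iff_getElem.1 ha
    rw [List.getElem_take]
    have hi' : i < m + 1 := by
      rw [List.length_take] at hi
      omega
    rcases Nat.lt_or_ge i m with him | him
    · have := List.pairwise_iff_getElem.1 hp i m (by omega) hlen him
      simp only [decide_eq_true_eq]
      omega
    · have : i = m := by omega
      subst this
      simpa using hcon
  have h2 := (List.take_sublist (m + 1) L).countP_le (p := fun d => decide (C < d))
  rw [h1, List.length_take] at h2
  omega

theorem stmt_17 (n k : ℕ) (hk : 3 ≤ k) (hn : 2 * k < n)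
    (F : Finset (Finset ℕ)) (hF : F ⊆ Finset.powersetCard k (Finset.Icc 1 n))
    (hint : ∀ A ∈ F, ∀ B ∈ F, (A ∩ B).Nonempty) :
    nthDegree n F (2 * k + 1) ≤ (n - 2).choose (k - 2) ∨
    F.card ≤ (n - 2).choose (k - 2) + 2 * (n - 3).choose (k - 2) := by
  by_cases hall : ∀ x ∈ Icc 1 n, (n-3).choose (k-2) ≤ #(F.filter fun A => x ∉ A)
  · right
    exact frankl_degree hk hn _ F rfl hF hint hall
  left
  push Not at hall
  obtain ⟨x, hx, hgx⟩ := hall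
  apply nthDegree_le
  set Bad := (Icc 1 n).filter fun y => (n - 2).choose (k - 2) < degree F y with hBad
  set H := F.filter fun A => x ∉ A with hH
  have hstep : ∀ y ∈ Bad.erase x, #H + 1 ≤ 2 * #(H.filter fun A => y ∈ A) := by
    intro y hy
    rw [mem_erase, hBad, mem_filter] at hy
    obtain ⟨hyx, hyn, hyd⟩ := hy
    have h1 : #(F.filter fun A => x ∉ A ∧ y ∉ A) < #(F.filter fun A => x ∉ A ∧ y ∈ A) := by
      by_contra hcon
      have := degree_lemma hk hn hx hyn (Ne.symm hyx) hF hint hgx (not_lt.1 hcon)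
      omega
    have h2 := card_filter_add_card_filter_not (s := H) (fun A => y ∈ A)
    rw [hH, filter_filter, filter_filter] at h2
    rw [hH, filter_filter]
    omega
  have hsum : ∑ y ∈ Icc 1 n, #(H.filter fun A => y ∈ A) = k * #H := by
    have := sum_card_bipartiteAbove_eq_sum_card_bipartiteBelow (s := Icc 1 n) (t := H)
      (fun y A => y ∈ A)
    unfold bipartiteAbove bipartiteBelow at this
    rw [this, mul_comm]
    apply sum_const_nat
    intro A hA
    have hA' := mem_powersetCard.1 (hF (mem_filter.1 hA).1)
    rw [filter_mem_eq_inter, inter_eq_right.2 hA'.1, hA'.2]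
  have hle : ∑ y ∈ Bad.erase x, #(H.filter fun A => y ∈ A)
      ≤ ∑ y ∈ Icc 1 n, #(H.filter fun A => y ∈ A) :=
    sum_le_sum_of_subset ((erase_subset _ _).trans (filter_subset _ _))
  have h3 : #(Bad.erase x) * (#H + 1) ≤ 2 * (k * #H) := by
    rw [← hsum]
    refine le_trans ?_ (Nat.mul_le_mul_left 2 hle)
    rw [mul_sum, ← smul_eq_mul]
    exact card_nsmul_le_sum _ _ _ hstep
  have h4 : #(Bad.erase x) < 2 * k := by
    by_contra hcon
    push Not at hcon
    have := Nat.mul_le_mul_right (#H + 1) hcon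
    nlinarith
  have h5 := pred_card_le_card_erase (s := Bad) (a := x)
  omega
end

section
/- Let k ≥ 3 and n > 2k, and let F ⊆ \binom{[n]}{k} be an intersecting family whose covering number equals 2, i.e., the minimum size of a set T ⊆ [n] with T ∩ F ≠ ∅ for every F ∈ F is 2. Then d_{2k+1}(F) < \binom{n-2}{k-2}. -/
open Finset

/-- Sets of size `l` in `Y ∪ R` with exactly `u` elements in `R`. -/
def lev (Y R : Finset ℕ) (l u : ℕ) : Finset (Finset ℕ) :=
  (Finset.powersetCard l (Y ∪ R)).filter fun S => (S ∩ R).card = u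

lemma mem_lev {Y R : Finset ℕ} {l u : ℕ} {S : Finset ℕ} :
    S ∈ lev Y R l u ↔ (S ⊆ Y ∪ R ∧ S.card = l) ∧ (S ∩ R).card = u := by
  simp [lev, Finset.mem_powersetCard]

lemma card_inter_Y {Y R : Finset ℕ} (h : Disjoint Y R) {S : Finset ℕ} (hS : S ⊆ Y ∪ R) :
    (S ∩ Y).card + (S ∩ R).card = S.card := by
  rw [← Finset.card_union_of_disjoint, ← Finset.inter_union_distrib_left,
    Finset.inter_eq_left.2 hS]
  exact h.mono Finset.inter_subset_right Finset.inter_subset_right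

lemma card_lev {Y R : Finset ℕ} (h : Disjoint Y R) {l u : ℕ} (hu : u ≤ l) :
    (lev Y R l u).card = Y.card.choose (l - u) * R.card.choose u := by
  rw [← Finset.card_powersetCard, ← Finset.card_powersetCard, ← Finset.card_product]
  refine Finset.card_nbij' (fun S => (S ∩ Y, S ∩ R)) (fun p => p.1 ∪ p.2) ?_ ?_ ?_ ?_
  · intro S hS
    have hS := mem_lev.1 hS
    have := card_inter_Y h hS.1.1
    simp only [Finset.coe_product, Set.mem_prod, Finset.mem_coe, Finset.mem_powersetCard]
    refine ⟨⟨Finset.inter_subset_right, ?_⟩, Finset.inter_subset_right, hS.2⟩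
    omega
  · rintro ⟨U, V⟩ hp
    simp only [Finset.coe_product, Set.mem_prod, Finset.mem_coe, Finset.mem_powersetCard] at hp
    obtain ⟨⟨hU, hUc⟩, hV, hVc⟩ := hp
    have hd : Disjoint U V := h.mono hU hV
    refine mem_lev.2 ⟨⟨Finset.union_subset_union hU hV, ?_⟩, ?_⟩
    · rw [Finset.card_union_of_disjoint hd]; omega
    · rw [Finset.union_inter_distrib_right, Finset.inter_eq_left.2 hV,
        Finset.disjoint_iff_inter_eq_empty.1 (h.mono_left hU), Finset.empty_union, hVc]
  · intro S hS
    have hS := mem_lev.1 hS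
    simp only [← Finset.inter_union_distrib_left, Finset.inter_eq_left.2 hS.1.1]
  · rintro ⟨U, V⟩ hp
    simp only [Finset.coe_product, Set.mem_prod, Finset.mem_coe, Finset.mem_powersetCard] at hp
    obtain ⟨⟨hU, hUc⟩, hV, hVc⟩ := hp
    simp only [Finset.union_inter_distrib_right, Finset.inter_eq_left.2 hV,
      Finset.inter_eq_left.2 hU,
        Finset.disjoint_iff_inter_eq_empty.1 (h.mono_left hU),
        Finset.disjoint_iff_inter_eq_empty.1 (h.symm.mono_left hV),
        Finset.empty_union, Finset.union_empty]

lemma lev_disj {Y R : Finset ℕ} {l v : ℕ} (S : Finset ℕ) :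
    (lev Y R l v).filter (fun T => Disjoint S T) = lev (Y \ S) (R \ S) l v := by
  ext T
  simp only [Finset.mem_filter, mem_lev]
  constructor
  · rintro ⟨⟨⟨h1, h2⟩, h3⟩, h4⟩
    refine ⟨⟨?_, h2⟩, ?_⟩
    · rw [← Finset.union_sdiff_distrib]
      exact Finset.subset_sdiff.2 ⟨h1, h4.symm⟩
    · rw [← h3]; congr 1
      ext x
      have := fun hx : x ∈ T => Finset.disjoint_right.1 h4 hx
      simp only [Finset.mem_inter, Finset.mem_sdiff]
      tauto
  · rintro ⟨⟨h1, h2⟩, h3⟩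
    rw [← Finset.union_sdiff_distrib, Finset.subset_sdiff] at h1
    refine ⟨⟨⟨h1.1, h2⟩, ?_⟩, h1.2.symm⟩
    rw [← h3]; congr 1
    ext x
    have := fun hx : x ∈ T => Finset.disjoint_left.1 h1.2 hx
    simp only [Finset.mem_inter, Finset.mem_sdiff]
    tauto

lemma card_nbr {Y R : Finset ℕ} (h : Disjoint Y R) {l u v : ℕ} (hv : v ≤ l)
    {S : Finset ℕ} (hS : S ∈ lev Y R l u) :
    ((lev Y R l v).filter (fun T => Disjoint S T)).card
      = (Y.card - (l - u)).choose (l - v) * (R.card - u).choose v := by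
  have hS := mem_lev.1 hS
  have := card_inter_Y h hS.1.1
  rw [lev_disj, card_lev (h.mono Finset.sdiff_subset Finset.sdiff_subset) hv,
    Finset.card_sdiff, Finset.card_sdiff, hS.2]
  congr 3
  omega

/-- biregular double counting -/
lemma bireg (P Q A B : Finset (Finset ℕ)) (D E : ℕ) (hD : 0 < D)
    (hP : ∀ S ∈ P, (Q.filter (fun T => Disjoint S T)).card = D)
    (hQ : ∀ T ∈ Q, (P.filter (fun S => Disjoint S T)).card = E)
    (hA : A ⊆ P) (hB : B ⊆ Q)
    (hc : ∀ S ∈ A, ∀ T ∈ B, ¬ Disjoint S T) :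
    A.card * Q.card + B.card * P.card ≤ P.card * Q.card := by
  have h1 : P.card * D = Q.card * E := by
    have := Finset.sum_card_bipartiteAbove_eq_sum_card_bipartiteBelow (s := P) (t := Q)
      (fun S T => Disjoint S T)
    simp only [Finset.bipartiteAbove, Finset.bipartiteBelow] at this
    rw [Finset.sum_congr rfl hP, Finset.sum_congr rfl hQ] at this
    simpa using this
  have h2 : A.card * D ≤ (Q \ B).card * E := by
    have := Finset.sum_card_bipartiteAbove_eq_sum_card_bipartiteBelow (s := A) (t := Q \ B)
      (fun S T => Disjoint S T)
    simp only [Finset.bipartiteAbove, Finset.bipartiteBelow] at this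
    rw [Finset.sum_congr rfl (g := fun _ => D)] at this
    · rw [Finset.sum_const, smul_eq_mul] at this
      rw [this, ← smul_eq_mul, ← Finset.sum_const]
      refine Finset.sum_le_sum fun T hT => ?_
      rw [← hQ T (Finset.mem_sdiff.1 hT).1]
      exact Finset.card_le_card (Finset.filter_subset_filter _ hA)
    · intro S hS
      rw [← hP S (hA hS)]
      congr 1
      ext T
      simp only [Finset.mem_filter, Finset.mem_sdiff]
      have := hc S hS T
      tauto
  have h3 : (Q \ B).card + B.card = Q.card := Finset.card_sdiff_add_card_eq_card hB
  refine Nat.le_of_mul_le_mul_right ?_ hD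
  calc (A.card * Q.card + B.card * P.card) * D
      = (A.card * D) * Q.card + B.card * (P.card * D) := by ring
    _ ≤ ((Q \ B).card * E) * Q.card + B.card * (P.card * D) :=
        Nat.add_le_add_right (Nat.mul_le_mul_right _ h2) _
    _ = (Q \ B).card * (Q.card * E) + B.card * (P.card * D) := by ring
    _ = ((Q \ B).card + B.card) * (P.card * D) := by rw [← h1]; ring
    _ = P.card * Q.card * D := by rw [h3]; ring

lemma choose_mono_half (N : ℕ) {i j : ℕ} (hij : i ≤ j) (hj : j ≤ N / 2) :
    N.choose i ≤ N.choose j := by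
  induction j, hij using Nat.le_induction with
  | base => exact le_rfl
  | succ j hj' ih => exact (ih (by omega)).trans (Nat.choose_le_succ_of_lt_half_left (by omega))

/-- If equality holds in the Kneser graph case, the family is everything or nothing. -/
lemma kneser_all {Y : Finset ℕ} {l : ℕ} (hY : Y.card = 2 * l + 1)
    (A B : Finset (Finset ℕ)) (hA : A ⊆ Finset.powersetCard l Y)
    (hB : B ⊆ Finset.powersetCard l Y)
    (hc : ∀ S ∈ A, ∀ T ∈ B, ¬ Disjoint S T)
    (heq : (Finset.powersetCard l Y).card ≤ A.card + B.card) (hne : A.Nonempty) :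
    A = Finset.powersetCard l Y := by
  set P := Finset.powersetCard l Y with hPdef
  have hP : ∀ S ∈ P, (P.filter (fun T => Disjoint S T)).card = (l + 1).choose l := by
    intro S hS
    have hS := Finset.mem_powersetCard.1 hS
    have : P.filter (fun T => Disjoint S T) = Finset.powersetCard l (Y \ S) := by
      ext T
      simp only [hPdef, Finset.mem_filter, Finset.mem_powersetCard, Finset.subset_sdiff]
      rw [disjoint_comm]; tauto
    rw [this, Finset.card_powersetCard, Finset.card_sdiff_of_subset hS.1]
    congr 1; omega
  have hP' : ∀ T ∈ P, (P.filter (fun S => Disjoint S T)).card = (l + 1).choose l := by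
    intro T hT
    simpa only [disjoint_comm] using hP T hT
  have key : ∀ T ∈ P \ B, ∀ S ∈ P, Disjoint S T → S ∈ A := by
    have e := Finset.sum_card_bipartiteAbove_eq_sum_card_bipartiteBelow (s := A) (t := P \ B)
      (fun S T => Disjoint S T)
    simp only [Finset.bipartiteAbove, Finset.bipartiteBelow] at e
    rw [Finset.sum_congr rfl (g := fun _ => (l + 1).choose l)] at e
    · have hle : ∀ T ∈ P \ B, (A.filter (fun S => Disjoint S T)).card ≤ (l + 1).choose l := by
        intro T hT
        rw [← hP' T (Finset.mem_sdiff.1 hT).1]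
        exact Finset.card_le_card (Finset.filter_subset_filter _ hA)
      have h3 : (P \ B).card + B.card = P.card := Finset.card_sdiff_add_card_eq_card hB
      have hge : ∑ T ∈ P \ B, (l + 1).choose l ≤
          ∑ T ∈ P \ B, (A.filter (fun S => Disjoint S T)).card := by
        rw [← e, Finset.sum_const, Finset.sum_const, smul_eq_mul, smul_eq_mul]
        exact Nat.mul_le_mul_right _ (by omega)
      have hall := (Finset.sum_eq_sum_iff_of_le hle).1 (le_antisymm (Finset.sum_le_sum hle) hge)
      intro T hT S hS hd
      have h4 := hall T hT
      rw [← hP' T (Finset.mem_sdiff.1 hT).1] at h4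
      have h5 := Finset.eq_of_subset_of_card_le
        (Finset.filter_subset_filter (fun S => Disjoint S T) hA) h4.ge
      have : S ∈ A.filter (fun S => Disjoint S T) := by
        rw [h5]; exact Finset.mem_filter.2 ⟨hS, hd⟩
      exact (Finset.mem_filter.1 this).1
    · intro S hS
      rw [← hP S (hA hS)]
      congr 1
      ext T
      simp only [Finset.mem_filter, Finset.mem_sdiff]
      have := hc S hS T
      tauto
  have swap : ∀ S ∈ A, ∀ S' ∈ P, (S ∪ S').card ≤ l + 1 → S' ∈ A := by
    intro S hS S' hS' hcard
    have hS1 := Finset.mem_powersetCard.1 (hA hS)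
    have hS2 := Finset.mem_powersetCard.1 hS'
    obtain ⟨T, hT, hTc⟩ := Finset.exists_subset_card_eq (s := Y \ (S ∪ S')) (n := l) (by
      rw [Finset.card_sdiff_of_subset (Finset.union_subset hS1.1 hS2.1)]; omega)
    rw [Finset.subset_sdiff, Finset.disjoint_union_right] at hT
    have hTP : T ∈ P := Finset.mem_powersetCard.2 ⟨hT.1, hTc⟩
    have hTB : T ∉ B := fun hh => hc S hS T hh hT.2.1.symm
    exact key T (Finset.mem_sdiff.2 ⟨hTP, hTB⟩) S' hS' hT.2.2.symm
  refine Finset.Subset.antisymm hA fun S hS => ?_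
  have main : ∀ d, ∀ S' ∈ A, (S \ S').card = d → S ∈ A := by
    intro d
    induction d with
    | zero =>
      intro S' hS' hd
      have h1 : S ⊆ S' := Finset.sdiff_eq_empty_iff_subset.1 (Finset.card_eq_zero.1 hd)
      have h2 := Finset.mem_powersetCard.1 (hA hS')
      have h3 := Finset.mem_powersetCard.1 hS
      rwa [Finset.eq_of_subset_of_card_le h1 (by omega)]
    | succ d ih =>
      intro S' hS' hd
      have h2 := Finset.mem_powersetCard.1 (hA hS')
      have h3 := Finset.mem_powersetCard.1 hS
      obtain ⟨z, hz⟩ : (S \ S').Nonempty := Finset.card_pos.1 (by omega)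
      obtain ⟨s, hs⟩ : (S' \ S).Nonempty := by
        rw [← Finset.card_pos]
        have := Finset.card_sdiff_add_card_inter S S'
        have := Finset.card_sdiff_add_card_inter S' S
        rw [Finset.inter_comm] at this
        omega
      rw [Finset.mem_sdiff] at hz hs
      have hcard : (insert z (S'.erase s)).card = l := by
        rw [Finset.card_insert_of_notMem, Finset.card_erase_of_mem hs.1, h2.2]
        · have := Finset.card_pos.2 ⟨s, hs.1⟩
          omega
        · exact fun hh => hz.2 (Finset.mem_of_mem_erase hh)
      refine ih (insert z (S'.erase s)) (swap S' hS' _ ?_ ?_) ?_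
      · refine Finset.mem_powersetCard.2 ⟨?_, hcard⟩
        exact Finset.insert_subset (h3.1 hz.1) ((Finset.erase_subset _ _).trans h2.1)
      · have : S' ∪ insert z (S'.erase s) ⊆ insert z S' := by
          refine Finset.union_subset (Finset.subset_insert _ _) ?_
          exact Finset.insert_subset_insert _ (Finset.erase_subset _ _)
        refine (Finset.card_le_card this).trans ?_
        rw [← h2.2]
        exact Finset.card_insert_le _ _
      · have : S \ insert z (S'.erase s) = (S \ S').erase z := by
          ext x
          simp only [Finset.mem_sdiff, Finset.mem_insert, Finset.mem_erase]
          by_cases hx : x = s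
          · subst hx; tauto
          · tauto
        rw [this, Finset.card_erase_of_mem (Finset.mem_sdiff.2 hz)]
        omega
  obtain ⟨S', hS'⟩ := hne
  exact main _ S' hS' rfl

/-- The analytic pairing inequality. -/
lemma pairing (r : ℕ) (w a b : ℕ → ℝ) (hw : ∀ u, 0 ≤ w u)
    (hmono : ∀ u, 2 * u ≤ r → w (r - u) ≤ w u)
    (h0 : r = 0 ∧ 0 < w 0 ∨ w r < w 0)
    (hab : ∀ u v, u + v ≤ r → a u + b v ≤ 1)
    (hs : a 0 + b 0 < 1) :
    ∑ u ∈ Finset.range (r + 1), w u * (a u + b u) < ∑ u ∈ Finset.range (r + 1), w u := by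
  have half : ∀ u, 2 * u ≤ r → w u * (a u + b u) + w (r - u) * (a (r - u) + b (r - u))
      ≤ w u + w (r - u) := by
    intro u hu
    have h1 := hab u u (by omega)
    have h2 := hab u (r - u) (by omega)
    have h3 := hab (r - u) u (by omega)
    nlinarith [hw (r - u), hmono u hu, mul_nonneg (sub_nonneg.2 (hmono u hu)) (sub_nonneg.2 h1),
      mul_nonneg (hw (r - u)) (sub_nonneg.2 h2), mul_nonneg (hw (r - u)) (sub_nonneg.2 h3)]
  have all : ∀ u ∈ Finset.range (r + 1),
      w u * (a u + b u) + w (r - u) * (a (r - u) + b (r - u)) ≤ w u + w (r - u) := by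
    intro u hu
    rw [Finset.mem_range] at hu
    by_cases h : 2 * u ≤ r
    · exact half u h
    · have := half (r - u) (by omega)
      rw [Nat.sub_sub_self (by omega)] at this
      linarith
  have strict : w 0 * (a 0 + b 0) + w (r - 0) * (a (r - 0) + b (r - 0)) < w 0 + w (r - 0) := by
    rw [Nat.sub_zero]
    rcases h0 with ⟨rfl, h⟩ | h
    · nlinarith
    · have h2 := hab 0 r (by omega)
      have h3 := hab r 0 (by omega)
      nlinarith [mul_pos (sub_pos.2 h) (sub_pos.2 hs),
        mul_nonneg (hw r) (sub_nonneg.2 h2), mul_nonneg (hw r) (sub_nonneg.2 h3)]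
  have hsum := Finset.sum_lt_sum all ⟨0, by simp, strict⟩
  rw [Finset.sum_add_distrib, Finset.sum_add_distrib] at hsum
  have r1 := Finset.sum_range_reflect (fun u => w u * (a u + b u)) (r + 1)
  have r2 := Finset.sum_range_reflect w (r + 1)
  simp only [Nat.add_sub_cancel] at r1 r2
  have e1 : ∀ f : ℕ → ℝ, ∑ u ∈ Finset.range (r + 1), f (r + 1 - 1 - u) =
    ∑ u ∈ Finset.range (r + 1), f (r - u) := fun f => rfl
  linarith

lemma sum_degree_eq {Y R : Finset ℕ} (h : Disjoint Y R) {l : ℕ} (A : Finset (Finset ℕ))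
    (hA : A ⊆ Finset.powersetCard l (Y ∪ R)) :
    ∑ x ∈ Y, degree A x =
      ∑ u ∈ Finset.range (R.card + 1), (l - u) * (A ∩ lev Y R l u).card := by
  have e1 : ∑ x ∈ Y, degree A x = ∑ S ∈ A, (S ∩ Y).card := by
    have := Finset.sum_card_bipartiteAbove_eq_sum_card_bipartiteBelow (s := Y) (t := A)
      (fun x S => x ∈ S)
    simp only [Finset.bipartiteAbove, Finset.bipartiteBelow] at this
    simp only [degree]
    rw [this]
    refine Finset.sum_congr rfl fun S _ => ?_
    congr 1
    ext x
    simp [and_comm]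
  rw [e1, ← Finset.sum_fiberwise_of_maps_to (t := Finset.range (R.card + 1))
    (g := fun S => (S ∩ R).card)]
  · refine Finset.sum_congr rfl fun u _ => ?_
    have : A.filter (fun S => (S ∩ R).card = u) = A ∩ lev Y R l u := by
      ext S
      simp only [Finset.mem_filter, Finset.mem_inter, lev]
      have := @hA S
      tauto
    rw [this, mul_comm, ← smul_eq_mul, ← Finset.sum_const]
    refine Finset.sum_congr rfl fun S hS => ?_
    have hS := mem_lev.1 (Finset.mem_inter.1 hS).2
    have := card_inter_Y h hS.1.1
    omega
  · intro S _
    rw [Finset.mem_range]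
    have := Finset.card_le_card (Finset.inter_subset_right : S ∩ R ⊆ R)
    omega

lemma degree_full {X : Finset ℕ} {l x : ℕ} (hl : 1 ≤ l) (hx : x ∈ X) :
    degree (Finset.powersetCard l X) x = (X.card - 1).choose (l - 1) := by
  rw [← Finset.card_erase_of_mem hx, ← Finset.card_powersetCard]
  unfold degree
  refine Finset.card_nbij' (fun S => S.erase x) (fun S => insert x S) ?_ ?_ ?_ ?_
  · intro S hS
    simp only [Finset.coe_filter, Finset.mem_powersetCard, Set.mem_setOf_eq] at hS
    simp only [Finset.mem_coe, Finset.mem_powersetCard]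
    exact ⟨Finset.erase_subset_erase _ hS.1.1, by rw [Finset.card_erase_of_mem hS.2, hS.1.2]⟩
  · intro S hS
    simp only [Finset.mem_coe, Finset.mem_powersetCard, Finset.subset_erase] at hS
    simp only [Finset.coe_filter, Finset.mem_powersetCard, Set.mem_setOf_eq]
    refine ⟨⟨Finset.insert_subset hx hS.1.1, ?_⟩, Finset.mem_insert_self _ _⟩
    rw [Finset.card_insert_of_notMem hS.1.2]; omega
  · intro S hS
    simp only [Finset.coe_filter, Set.mem_setOf_eq] at hS
    exact Finset.insert_erase hS.2
  · intro S hS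
    simp only [Finset.mem_coe, Finset.mem_powersetCard, Finset.subset_erase] at hS
    exact Finset.erase_insert hS.1.2

lemma lev_zero {Y R : Finset ℕ} (h : Disjoint Y R) (l : ℕ) :
    lev Y R l 0 = Finset.powersetCard l Y := by
  ext S
  rw [mem_lev, Finset.mem_powersetCard, Finset.card_eq_zero, ← Finset.disjoint_iff_inter_eq_empty]
  constructor
  · rintro ⟨⟨h1, h2⟩, h3⟩
    refine ⟨fun x hx => ?_, h2⟩
    rcases Finset.mem_union.1 (h1 hx) with h4 | h4
    · exact h4
    · exact absurd h4 (Finset.disjoint_left.1 h3 hx)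
  · rintro ⟨h1, h2⟩
    exact ⟨⟨h1.trans Finset.subset_union_left, h2⟩, h.mono_left h1⟩

lemma core {Y R : Finset ℕ} (h : Disjoint Y R) {l : ℕ} (hl : 1 ≤ l) (hY : Y.card = 2 * l + 1)
    (A B : Finset (Finset ℕ)) (hA : A ⊆ Finset.powersetCard l (Y ∪ R))
    (hB : B ⊆ Finset.powersetCard l (Y ∪ R)) (hAn : A.Nonempty) (hBn : B.Nonempty)
    (hc : ∀ S ∈ A, ∀ T ∈ B, ¬ Disjoint S T) :
    ∑ x ∈ Y, (degree A x + degree B x) < (2 * l + 1) * ((Y ∪ R).card - 1).choose (l - 1) := by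
  have hfull : ∑ x ∈ Y, degree (Finset.powersetCard l (Y ∪ R)) x
      = (2 * l + 1) * ((Y ∪ R).card - 1).choose (l - 1) := by
    rw [Finset.sum_congr rfl fun x hx => degree_full hl (Finset.mem_union_left R hx),
      Finset.sum_const, smul_eq_mul, hY]
  rw [← hfull, Finset.sum_add_distrib, sum_degree_eq h A hA, sum_degree_eq h B hB,
    sum_degree_eq h _ subset_rfl, ← Finset.sum_add_distrib]
  set r := R.card with hr
  let L : ℕ → ℕ := fun u => (lev Y R l u).card
  let a : ℕ → ℝ := fun u => ((A ∩ lev Y R l u).card : ℝ) / L u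
  let b : ℕ → ℝ := fun u => ((B ∩ lev Y R l u).card : ℝ) / L u
  let w : ℕ → ℝ := fun u => (((l - u) * L u : ℕ) : ℝ)
  have hle : ∀ (C : Finset (Finset ℕ)) u, (C ∩ lev Y R l u).card ≤ L u :=
    fun C u => Finset.card_le_card Finset.inter_subset_right
  have hcan : ∀ (C : Finset (Finset ℕ)) u,
      (L u : ℝ) * (((C ∩ lev Y R l u).card : ℝ) / L u) = ((C ∩ lev Y R l u).card : ℝ) := by
    intro C u
    by_cases h0 : L u = 0
    · have := hle C u
      rw [h0] at this ⊢
      have : (C ∩ lev Y R l u).card = 0 := by omega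
      rw [this]; simp
    · have : (L u : ℝ) ≠ 0 := by exact_mod_cast h0
      field_simp
  have hinter : ∀ u, Finset.powersetCard l (Y ∪ R) ∩ lev Y R l u = lev Y R l u := by
    intro u
    exact Finset.inter_eq_right.2 (Finset.filter_subset _ _)
  have hmain : ∑ u ∈ Finset.range (r + 1), w u * (a u + b u) <
      ∑ u ∈ Finset.range (r + 1), w u := by
    have hw0 : ∀ u, u < l → w u = (((l - u) * ((2 * l + 1).choose (l - u) * r.choose u) : ℕ) : ℝ) := by
      intro u hu
      simp only [w, L]
      rw [card_lev h hu.le, hY]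
    have hwl : ∀ u, l ≤ u → w u = 0 := by
      intro u hu
      simp only [w]
      rw [Nat.sub_eq_zero_of_le hu]; simp
    have hw : ∀ u, 0 ≤ w u := fun u => Nat.cast_nonneg _
    refine pairing r w a b hw ?_ ?_ ?_ ?_
    · intro u hu
      by_cases hlu : l ≤ r - u
      · rw [hwl _ hlu]; exact hw u
      · rw [hw0 _ (by omega), hw0 u (by omega), Nat.choose_symm (by omega)]
        norm_cast
        refine Nat.mul_le_mul (by omega) (Nat.mul_le_mul_right _ ?_)
        exact choose_mono_half _ (by omega) (by omega)
    · have hp : 0 < w 0 := by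
        rw [hw0 0 (by omega)]
        have := Nat.choose_pos (n := 2 * l + 1) (k := l) (by omega)
        norm_cast
        simp only [Nat.sub_zero, Nat.choose_zero_right, mul_one]
        positivity
      by_cases h0 : r = 0
      · exact Or.inl ⟨h0, hp⟩
      · right
        by_cases hlu : l ≤ r
        · rw [hwl _ hlu]; exact hp
        · rw [hw0 _ (by omega), hw0 0 (by omega)]
          have h1 : (2 * l + 1).choose (l - r) ≤ (2 * l + 1).choose l :=
            choose_mono_half _ (by omega) (by omega)
          have h2 := Nat.choose_pos (n := 2 * l + 1) (k := l) (by omega)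
          norm_cast
          simp only [Nat.sub_zero, Nat.choose_zero_right, mul_one, Nat.choose_self]
          exact (Nat.mul_le_mul_left _ h1).trans_lt (Nat.mul_lt_mul_of_pos_right (by omega) h2)
    · intro u v huv
      by_cases hu0 : L u = 0
      · simp only [a, b]
        rw [hu0]
        simp only [Nat.cast_zero, div_zero, zero_add]
        exact div_le_one_of_le₀ (by exact_mod_cast hle B v) (Nat.cast_nonneg _)
      by_cases hv0 : L v = 0
      · simp only [a, b]
        rw [hv0]
        simp only [Nat.cast_zero, div_zero, add_zero]
        exact div_le_one_of_le₀ (by exact_mod_cast hle A u) (Nat.cast_nonneg _)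
      have hul : ∀ u, L u ≠ 0 → u ≤ l := by
        intro u hu
        obtain ⟨S, hS⟩ := Finset.card_ne_zero.1 hu
        have hS := mem_lev.1 hS
        have := Finset.card_le_card (Finset.inter_subset_left : S ∩ R ⊆ S)
        omega
      have hu := hul u hu0
      have hv := hul v hv0
      have := bireg (lev Y R l u) (lev Y R l v) (A ∩ lev Y R l u) (B ∩ lev Y R l v)
        ((Y.card - (l - u)).choose (l - v) * (R.card - u).choose v)
        ((Y.card - (l - v)).choose (l - u) * (R.card - v).choose u)
        (Nat.mul_pos (Nat.choose_pos (by omega)) (Nat.choose_pos (by omega)))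
        (fun S hS => card_nbr h hv hS)
        (fun T hT => by simpa only [disjoint_comm] using card_nbr h hu hT)
        Finset.inter_subset_right Finset.inter_subset_right
        (fun S hS T hT => hc S (Finset.mem_inter.1 hS).1 T (Finset.mem_inter.1 hT).1)
      have hup : (0 : ℝ) < L u := by exact_mod_cast Nat.pos_of_ne_zero hu0
      have hvp : (0 : ℝ) < L v := by exact_mod_cast Nat.pos_of_ne_zero hv0
      simp only [a, b]
      rw [div_add_div _ _ hup.ne' hvp.ne', div_le_one (by positivity)]
      have h2 : (A ∩ lev Y R l u).card * L v + L u * (B ∩ lev Y R l v).card ≤ L u * L v := by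
        rw [mul_comm (L u)]; exact this
      exact_mod_cast h2
    · have hL : 0 < L 0 := by
        simp only [L]
        rw [lev_zero h, Finset.card_powersetCard]
        exact Nat.choose_pos (by omega)
      have hLr : (0 : ℝ) < L 0 := by exact_mod_cast hL
      simp only [a, b]
      rw [← add_div, div_lt_one hLr]
      by_contra hcon
      rw [not_lt] at hcon
      have hcon : L 0 ≤ (A ∩ lev Y R l 0).card + (B ∩ lev Y R l 0).card := by exact_mod_cast hcon
      have escape : ∀ S ∈ Finset.powersetCard l (Y ∪ R), ∃ T ∈ lev Y R l 0, Disjoint S T := by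
        intro S hS
        have hS := Finset.mem_powersetCard.1 hS
        obtain ⟨T, hT, hTc⟩ := Finset.exists_subset_card_eq (s := Y \ S) (n := l) (by
          have := Finset.le_card_sdiff S Y
          omega)
        rw [Finset.subset_sdiff] at hT
        refine ⟨T, ?_, hT.2.symm⟩
        rw [lev_zero h]
        exact Finset.mem_powersetCard.2 ⟨hT.1, hTc⟩
      have hAor : A ∩ lev Y R l 0 = lev Y R l 0 ∨ B ∩ lev Y R l 0 = lev Y R l 0 := by
        by_cases hne : (A ∩ lev Y R l 0).Nonempty
        · left
          have := kneser_all hY (A ∩ lev Y R l 0) (B ∩ lev Y R l 0)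
            (by rw [← lev_zero h]; exact Finset.inter_subset_right)
            (by rw [← lev_zero h]; exact Finset.inter_subset_right)
            (fun S hS T hT => hc S (Finset.mem_inter.1 hS).1 T (Finset.mem_inter.1 hT).1)
            (by rw [← lev_zero h]; exact hcon) hne
          rw [this, lev_zero h]
        · right
          rw [Finset.not_nonempty_iff_eq_empty] at hne
          rw [hne, Finset.card_empty, zero_add] at hcon
          exact Finset.eq_of_subset_of_card_le Finset.inter_subset_right hcon
      rcases hAor with hh | hh
      · obtain ⟨T, hT⟩ := hBn
        obtain ⟨S, hS, hd⟩ := escape T (hB hT)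
        exact hc S (Finset.inter_eq_right.1 hh hS) T hT hd.symm
      · obtain ⟨S, hS⟩ := hAn
        obtain ⟨T, hT, hd⟩ := escape S (hA hS)
        exact hc S hS T (Finset.inter_eq_right.1 hh hT) hd
  have e1 : ∀ u, w u * (a u + b u) =
      (((l - u) * (A ∩ lev Y R l u).card + (l - u) * (B ∩ lev Y R l u).card : ℕ) : ℝ) := by
    intro u
    have h1 := hcan A u
    have h2 := hcan B u
    simp only [w, a, b]
    rw [Nat.cast_mul, mul_assoc, mul_add, h1, h2]
    push_cast
    ring
  have e2 : ∀ u, w u =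
      (((l - u) * (Finset.powersetCard l (Y ∪ R) ∩ lev Y R l u).card : ℕ) : ℝ) := by
    intro u
    rw [hinter]
  rw [Finset.sum_congr rfl fun u _ => e1 u, Finset.sum_congr rfl fun u _ => e2 u] at hmain
  exact_mod_cast hmain

lemma many_of_nthDegree {n i c : ℕ} (F : Finset (Finset ℕ)) (hi : i < n)
    (h : c ≤ nthDegree n F (i + 1)) :
    i + 1 ≤ ((Finset.Icc 1 n).filter fun x => c ≤ degree F x).card := by
  unfold nthDegree at h
  set M := (Finset.Icc 1 n).val.map (degree F) with hM
  set s := M.sort (· ≥ ·) with hs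
  have hlen : s.length = n := by simp [hs, hM]
  have hsort : s.Pairwise (· ≥ ·) := Multiset.pairwise_sort _ _
  rw [Nat.add_sub_cancel, List.getD_eq_getElem _ _ (by omega)] at h
  have h1 : ∀ x ∈ s.take (i + 1), decide (c ≤ x) = true := by
    intro x hx
    obtain ⟨j, hj, rfl⟩ := List.mem_iff_getElem.1 hx
    rw [List.length_take] at hj
    rw [List.getElem_take, decide_eq_true_eq]
    refine h.trans ?_
    rcases Nat.lt_or_ge j i with hji | hji
    · exact List.pairwise_iff_getElem.1 hsort j i (by omega) (by omega) hji
    · have : j = i := by omega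
      subst this
      exact le_rfl
  have h2 : (s.take (i + 1)).countP (fun x => decide (c ≤ x)) = i + 1 := by
    rw [List.countP_eq_length.2 h1, List.length_take]; omega
  have h3 : i + 1 ≤ s.countP (fun x => decide (c ≤ x)) := by
    rw [← h2]
    exact (List.take_sublist _ _).countP_le
  have h4 : (s.countP fun x => decide (c ≤ x)) = M.countP (fun x => c ≤ x) := by
    rw [← Multiset.coe_countP, hs, Multiset.sort_eq]
  rw [h4, hM, Multiset.countP_map] at h3
  exact h3

theorem stmt_18 (n k : ℕ) (hk : 3 ≤ k) (hn : 2 * k < n)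
    (F : Finset (Finset ℕ)) (hF : F ⊆ Finset.powersetCard k (Finset.Icc 1 n))
    (hint : ∀ A ∈ F, ∀ B ∈ F, (A ∩ B).Nonempty)
    (hτ : sInf {m : ℕ | ∃ T ⊆ Finset.Icc 1 n, T.card = m ∧
      ∀ A ∈ F, (T ∩ A).Nonempty} = 2) :
    nthDegree n F (2 * k + 1) < (n - 2).choose (k - 2) := by
  by_contra hcon
  rw [not_lt] at hcon
  have hmany := many_of_nthDegree F hn hcon
  obtain ⟨T, hTs, hT2, hTc⟩ : 2 ∈ {m : ℕ | ∃ T ⊆ Finset.Icc 1 n, T.card = m ∧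
      ∀ A ∈ F, (T ∩ A).Nonempty} := by
    rw [← hτ]
    refine Nat.sInf_mem (Nat.nonempty_of_pos_sInf ?_)
    omega
  have hone : ∀ c ∈ Finset.Icc 1 n, ∃ G ∈ F, c ∉ G := by
    intro c hcn
    by_contra hno
    push Not at hno
    have : sInf {m : ℕ | ∃ T ⊆ Finset.Icc 1 n, T.card = m ∧
      ∀ A ∈ F, (T ∩ A).Nonempty} ≤ 1 := by
      refine Nat.sInf_le ⟨{c}, by simpa using hcn, by simp, fun G hG => ⟨c, ?_⟩⟩
      simp [hno G hG]
    omega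
  obtain ⟨a, b, hab, rfl⟩ := Finset.card_eq_two.1 hT2
  have han : a ∈ Finset.Icc 1 n := hTs (by simp)
  have hbn : b ∈ Finset.Icc 1 n := hTs (by simp)
  have hcov : ∀ G ∈ F, a ∈ G ∨ b ∈ G := by
    intro G hG
    obtain ⟨x, hx⟩ := hTc G hG
    simp only [Finset.mem_inter, Finset.mem_insert, Finset.mem_singleton] at hx
    rcases hx with ⟨rfl | rfl, hx⟩
    · exact Or.inl hx
    · exact Or.inr hx
  set X := ((Finset.Icc 1 n).erase a).erase b with hX
  have hXc : X.card = n - 2 := by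
    rw [hX, Finset.card_erase_of_mem (Finset.mem_erase.2 ⟨hab.symm, hbn⟩),
      Finset.card_erase_of_mem han, Nat.card_Icc]
    omega
  have haX : a ∉ X := by simp [hX]
  have hbX : b ∉ X := by simp [hX]
  have hXmem : ∀ x, x ∈ X ↔ x ≠ b ∧ x ≠ a ∧ x ∈ Finset.Icc 1 n := by
    intro x; simp only [hX, Finset.mem_erase]
  have hFm : ∀ G ∈ F, G ⊆ Finset.Icc 1 n ∧ G.card = k :=
    fun G hG => Finset.mem_powersetCard.1 (hF hG)
  let A := (Finset.powersetCard (k - 1) X).filter fun S => insert a S ∈ F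
  let B := (Finset.powersetCard (k - 1) X).filter fun S => insert b S ∈ F
  have memA : ∀ G ∈ F, a ∈ G → b ∉ G → G.erase a ∈ A := by
    intro G hG h1 h2
    refine Finset.mem_filter.2 ⟨Finset.mem_powersetCard.2 ⟨fun x hx => ?_, ?_⟩, ?_⟩
    · rw [Finset.mem_erase] at hx
      exact (hXmem x).2 ⟨fun e => h2 (e ▸ hx.2), hx.1, (hFm G hG).1 hx.2⟩
    · rw [Finset.card_erase_of_mem h1, (hFm G hG).2]
    · rwa [Finset.insert_erase h1]
  have memB : ∀ G ∈ F, b ∈ G → a ∉ G → G.erase b ∈ B := by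
    intro G hG h1 h2
    refine Finset.mem_filter.2 ⟨Finset.mem_powersetCard.2 ⟨fun x hx => ?_, ?_⟩, ?_⟩
    · rw [Finset.mem_erase] at hx
      exact (hXmem x).2 ⟨hx.1, fun e => h2 (e ▸ hx.2), (hFm G hG).1 hx.2⟩
    · rw [Finset.card_erase_of_mem h1, (hFm G hG).2]
    · rwa [Finset.insert_erase h1]
  have hAn : A.Nonempty := by
    obtain ⟨G, hG, hb⟩ := hone b hbn
    exact ⟨_, memA G hG ((hcov G hG).resolve_right hb) hb⟩
  have hBn : B.Nonempty := by
    obtain ⟨G, hG, hb⟩ := hone a han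
    exact ⟨_, memB G hG ((hcov G hG).resolve_left hb) hb⟩
  have hcross : ∀ S ∈ A, ∀ T ∈ B, ¬ Disjoint S T := by
    intro S hS T hT hd
    obtain ⟨hS1, hS2⟩ := Finset.mem_filter.1 hS
    obtain ⟨hT1, hT2⟩ := Finset.mem_filter.1 hT
    have hS1 := (Finset.mem_powersetCard.1 hS1).1
    have hT1 := (Finset.mem_powersetCard.1 hT1).1
    obtain ⟨x, hx⟩ := hint _ hS2 _ hT2
    simp only [Finset.mem_inter, Finset.mem_insert] at hx
    rcases hx with ⟨rfl | hxS, hx2⟩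
    · rcases hx2 with e | hxT
      · exact hab e
      · exact haX (hT1 hxT)
    · rcases hx2 with rfl | hxT
      · exact hbX (hS1 hxS)
      · exact Finset.disjoint_left.1 hd hxS hxT
  have hdeg : ∀ x ∈ X, degree F x ≤ (n - 3).choose (k - 3) + (degree A x + degree B x) := by
    intro x hx
    have hxX := (hXmem x).1 hx
    have hsub : F.filter (fun G => x ∈ G) ⊆
        ((Finset.powersetCard (k - 3) (X.erase x)).image fun S => insert a (insert b (insert x S)))
        ∪ (((A.filter fun S => x ∈ S).image fun S => insert a S)
        ∪ ((B.filter fun S => x ∈ S).image fun S => insert b S)) := by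
      intro G hG
      obtain ⟨hG, hxG⟩ := Finset.mem_filter.1 hG
      simp only [Finset.mem_union, Finset.mem_image]
      by_cases ha : a ∈ G
      · by_cases hb : b ∈ G
        · left
          have hb' : b ∈ G.erase a := Finset.mem_erase.2 ⟨hab.symm, hb⟩
          have hx' : x ∈ (G.erase a).erase b :=
            Finset.mem_erase.2 ⟨hxX.1, Finset.mem_erase.2 ⟨hxX.2.1, hxG⟩⟩
          refine ⟨((G.erase a).erase b).erase x, ?_, ?_⟩
          · refine Finset.mem_powersetCard.2 ⟨Finset.erase_subset_erase _
              (Finset.erase_subset_erase _ (Finset.erase_subset_erase _ (hFm G hG).1)), ?_⟩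
            rw [Finset.card_erase_of_mem hx', Finset.card_erase_of_mem hb',
              Finset.card_erase_of_mem ha, (hFm G hG).2]
            omega
          · rw [Finset.insert_erase hx', Finset.insert_erase hb', Finset.insert_erase ha]
        · right; left
          exact ⟨G.erase a, Finset.mem_filter.2 ⟨memA G hG ha hb,
            Finset.mem_erase.2 ⟨hxX.2.1, hxG⟩⟩, Finset.insert_erase ha⟩
      · right; right
        have hb := (hcov G hG).resolve_left ha
        exact ⟨G.erase b, Finset.mem_filter.2 ⟨memB G hG hb ha,
            Finset.mem_erase.2 ⟨hxX.1, hxG⟩⟩, Finset.insert_erase hb⟩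
    refine (Finset.card_le_card hsub).trans ((Finset.card_union_le _ _).trans ?_)
    refine Nat.add_le_add ?_ ((Finset.card_union_le _ _).trans
      (Nat.add_le_add Finset.card_image_le Finset.card_image_le))
    refine Finset.card_image_le.trans ?_
    rw [Finset.card_powersetCard, Finset.card_erase_of_mem hx, hXc]
    exact le_of_eq (by congr 1)
  obtain ⟨Y, hYs, hYc⟩ := Finset.exists_subset_card_eq
    (s := (((Finset.Icc 1 n).filter fun x => (n - 2).choose (k - 2) ≤ degree F x).erase a).erase b)
    (n := 2 * (k - 1) + 1) (by
      have h1 := Finset.pred_card_le_card_erase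
        (s := (Finset.Icc 1 n).filter fun x => (n - 2).choose (k - 2) ≤ degree F x) (a := a)
      have h2 := Finset.pred_card_le_card_erase
        (s := ((Finset.Icc 1 n).filter fun x => (n - 2).choose (k - 2) ≤ degree F x).erase a)
        (a := b)
      omega)
  have hYX : Y ⊆ X := hYs.trans
    (Finset.erase_subset_erase _ (Finset.erase_subset_erase _ (Finset.filter_subset _ _)))
  have hYd : ∀ x ∈ Y, (n - 3).choose (k - 2) ≤ degree A x + degree B x := by
    intro x hx
    have h1 := hdeg x (hYX hx)
    have h2 := hYs hx
    simp only [Finset.mem_erase, Finset.mem_filter] at h2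
    have h3 := h2.2.2.2
    have h4 : (n - 2).choose (k - 2) = (n - 3).choose (k - 3) + (n - 3).choose (k - 2) := by
      obtain ⟨n', rfl⟩ := Nat.exists_eq_add_of_le (show 3 ≤ n by omega)
      obtain ⟨k', rfl⟩ := Nat.exists_eq_add_of_le hk
      rw [show 3 + n' - 2 = n' + 1 by omega, show 3 + k' - 2 = k' + 1 by omega,
        show 3 + n' - 3 = n' by omega, show 3 + k' - 3 = k' by omega, Nat.choose_succ_succ]
    omega
  have hU : Y ∪ (X \ Y) = X := Finset.union_sdiff_of_subset hYX
  have hcore := core (Y := Y) (R := X \ Y) Finset.disjoint_sdiff (l := k - 1) (by omega) hYc A B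
    (by rw [hU]; exact Finset.filter_subset _ _) (by rw [hU]; exact Finset.filter_subset _ _)
    hAn hBn hcross
  rw [hU, hXc, show n - 2 - 1 = n - 3 by omega, show k - 1 - 1 = k - 2 by omega, ← hYc,
    ← smul_eq_mul, ← Finset.sum_const] at hcore
  exact absurd (Finset.sum_le_sum hYd) (not_le.2 hcore)
end
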